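/- arXiv:2512.15077 — 2 statements merged into one kernel-verified Lean document; each statement's English description precedes it below -/
import Mathlib

section
/- For every ε > 0 there exists n₀ such that for all n ≥ n₀, if B_n is an n × n random matrix whose entries are independent and uniform in {-1, 1}, then ℙ(det(B_n) = 0) ≤ 2^{(-1 + ε) n}. -/
namespace SignMatrix

open Finset
open scoped BigOperators ComplexConjugate

/-! ### Averages and probabilities over finite types -/

open scoped Classical in
/-- The probability of `p` under the uniform distribution on a finite type. -/
noncomputable def pr {α : Type*} [Fintype α] (p : α → Prop) : ℝ :=
  𝔼 a, if p a then (1 : ℝ) else 0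

section Pr

variable {α β : Type*} [Fintype α] [Fintype β]

lemma pr_nonneg (p : α → Prop) : 0 ≤ pr p :=
  expect_nonneg fun a _ => by split_ifs <;> norm_num

lemma pr_mono {p q : α → Prop} (h : ∀ a, p a → q a) : pr p ≤ pr q := by
  refine expect_le_expect fun a _ => ?_
  by_cases hp : p a
  · simp [hp, h a hp]
  · by_cases hq : q a <;> simp [hp, hq]

lemma pr_le_one (p : α → Prop) : pr p ≤ 1 := by
  rcases isEmpty_or_nonempty α with h | h
  · simp [pr]
  · exact expect_le univ_nonempty fun a _ => by split_ifs <;> norm_num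

lemma pr_false {p : α → Prop} (h : ∀ a, ¬ p a) : pr p = 0 := by
  simp [pr, h]

lemma pr_or_le (p q : α → Prop) : pr (fun a => p a ∨ q a) ≤ pr p + pr q := by
  rw [pr, pr, pr, ← expect_add_distrib]
  refine expect_le_expect fun a _ => ?_
  by_cases hp : p a <;> by_cases hq : q a <;> simp [hp, hq]

lemma pr_exists_mem_le {γ : Type*} (s : Finset γ) (p : γ → α → Prop) :
    pr (fun a => ∃ c ∈ s, p c a) ≤ ∑ c ∈ s, pr (p c) := by
  classical
  simp only [pr]
  rw [← expect_sum_comm]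
  refine expect_le_expect fun a _ => ?_
  have hnn : ∀ c ∈ s, (0 : ℝ) ≤ (if p c a then (1 : ℝ) else 0) := fun c _ => by
    split_ifs <;> norm_num
  split_ifs with h
  · obtain ⟨c, hc, hpc⟩ := h
    calc (1 : ℝ) = if p c a then (1 : ℝ) else 0 := by simp [hpc]
      _ ≤ _ := single_le_sum hnn hc
  · exact sum_nonneg hnn

lemma pr_equiv (e : α ≃ β) (p : β → Prop) : pr (fun a => p (e a)) = pr p :=
  Fintype.expect_equiv e _ _ fun _ => rfl

lemma pr_eq_card (p : α → Prop) [DecidablePred p] :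
    pr p = (#{a | p a} : ℝ) / Fintype.card α := by
  rw [pr, Fintype.expect_eq_sum_div_card]
  congr 1
  rw [← sum_boole]
  congr!

lemma pr_prod (p : α × β → Prop) : pr p = 𝔼 b, pr (fun a => p (a, b)) := by
  rw [pr, ← univ_product_univ, expect_product, expect_comm]
  rfl

lemma pr_lt_le_div {f : α → ℝ} (hf : ∀ a, 0 ≤ f a) {c : ℝ} (hc : 0 < c) :
    pr (fun a => c < f a) ≤ (𝔼 a, f a) / c := by
  rw [expect_div]
  refine expect_le_expect fun a _ => ?_
  split_ifs with h
  · rw [one_le_div hc]; exact h.le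
  · have := hf a; positivity

/-- Conditioning on the second coordinate outside an exceptional event. -/
lemma pr_prod_le {p : α × β → Prop} {q : β → Prop} {A B : ℝ} (hB : 0 ≤ B) (hA : pr q ≤ A)
    (h : ∀ b, ¬ q b → pr (fun a => p (a, b)) ≤ B) : pr p ≤ A + B := by
  classical
  rcases isEmpty_or_nonempty β with hβ | hβ
  · have : pr p = 0 := pr_false fun x => isEmptyElim x.2
    have := pr_nonneg q
    linarith
  calc pr p = 𝔼 b, pr (fun a => p (a, b)) := pr_prod p
    _ ≤ 𝔼 b, ((if q b then (1 : ℝ) else 0) + B) := by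
        refine expect_le_expect fun b _ => ?_
        split_ifs with hq
        · have := pr_le_one fun a => p (a, b)
          linarith
        · simpa using h b hq
    _ = pr q + B := by
        rw [expect_add_distrib, Fintype.expect_const, pr]
    _ ≤ A + B := by linarith

lemma expect_pi_prod {ι : Type*} [Fintype ι] [DecidableEq ι] {K : Type*} [Field K] [CharZero K]
    (f : ι → α → K) :
    𝔼 x : ι → α, ∏ i, f i (x i) = ∏ i, 𝔼 a, f i a := by
  simp_rw [Fintype.expect_eq_sum_div_card]
  rw [prod_div_distrib, prod_univ_sum, Fintype.piFinset_univ]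
  simp

lemma pr_pi {ι : Type*} [Fintype ι] [DecidableEq ι] (p : ι → α → Prop) :
    pr (fun x : ι → α => ∀ i, p i (x i)) = ∏ i, pr (p i) := by
  classical
  simp only [pr]
  rw [← expect_pi_prod]
  refine expect_congr rfl fun x _ => ?_
  by_cases h : ∀ i, p i (x i)
  · simp [h]
  · obtain ⟨i, hi⟩ := not_forall.mp h
    rw [if_neg h, prod_eq_zero (mem_univ i)]
    simp [hi]

end Pr

/-! ### Random signed sums -/

/-- The sign encoded by a Boolean. -/
def sgn (b : Bool) : ℤ := cond b 1 (-1)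

section Walk

variable {ι κ R : Type*} [Fintype ι] [Fintype κ] [CommRing R]

/-- The signed sum of the family `x`. -/
def signSum (ε : ι → Bool) (x : ι → R) : R := ∑ i, (sgn (ε i) : R) * x i

lemma signSum_comp_equiv (e : κ ≃ ι) (ε : ι → Bool) (x : ι → R) :
    signSum (ε ∘ e) (x ∘ e) = signSum ε x :=
  Fintype.sum_equiv e _ _ fun _ => rfl

variable [DecidableEq ι] [DecidableEq κ]

/-- The average of `f` over all signed sums of `x` started at `z`. -/
noncomputable def walk (x : ι → R) (f : R → ℝ) (z : R) : ℝ :=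
  𝔼 ε : ι → Bool, f (z + signSum ε x)

lemma walk_sumElim (x : ι → R) (y : κ → R) (f : R → ℝ) :
    walk (Sum.elim x y) f = walk x (walk y f) := by
  ext z
  simp only [walk]
  rw [Fintype.expect_equiv (Equiv.sumArrowEquivProdArrow ι κ Bool) _
    (fun p => f (z + signSum p.1 x + signSum p.2 y)), ← univ_product_univ, expect_product]
  intro ε
  congr 1
  simp [signSum, Equiv.sumArrowEquivProdArrow, add_assoc]

lemma walk_comp_equiv (e : κ ≃ ι) (x : ι → R) (f : R → ℝ) : walk (x ∘ e) f = walk x f := by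
  ext z
  refine (Fintype.expect_equiv (e.arrowCongr (Equiv.refl Bool)).symm _ _ fun ε => ?_).symm
  rw [show (e.arrowCongr (Equiv.refl Bool)).symm ε = ε ∘ e from rfl, signSum_comp_equiv]

lemma walk_nonneg (x : ι → R) {f : R → ℝ} (hf : ∀ z, 0 ≤ f z) (z : R) : 0 ≤ walk x f z :=
  expect_nonneg fun _ _ => hf _

lemma walk_mono (x : ι → R) {f g : R → ℝ} (h : ∀ z, f z ≤ g z) (z : R) :
    walk x f z ≤ walk x g z :=
  expect_le_expect fun _ _ => h _

lemma walk_le (x : ι → R) {f : R → ℝ} {H : ℝ} (hf : ∀ z, f z ≤ H) (z : R) :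
    walk x f z ≤ H :=
  expect_le univ_nonempty fun _ _ => hf _

lemma expect_walk [Fintype R] (x : ι → R) (f : R → ℝ) : 𝔼 z, walk x f z = 𝔼 z, f z := by
  simp only [walk]
  rw [expect_comm]
  have : ∀ ε : ι → Bool, 𝔼 z, f (z + signSum ε x) = 𝔼 z, f z := fun ε =>
    Fintype.expect_equiv (Equiv.addRight (signSum ε x)) _ _ fun _ => rfl
  simp [this]

end Walk

/-! ### Sign vectors modulo three -/

/-- The reduction of a sign vector modulo three. -/
def signVec {ι : Type*} (ε : ι → Bool) : ι → ZMod 3 := fun i => (sgn (ε i) : ZMod 3)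

lemma sgn_cast_injective : Function.Injective fun b : Bool => (sgn b : ZMod 3) := by
  intro a b h
  revert a b
  decide

/-- Odlyzko's bound: a `d`-dimensional subspace contains at most `2 ^ d` sign vectors. -/
lemma pr_signVec_mem_le {ι : Type*} [Fintype ι] [DecidableEq ι]
    (W : Submodule (ZMod 3) (ι → ZMod 3)) :
    pr (fun ε : ι → Bool => signVec ε ∈ W) ≤
      2 ^ Module.finrank (ZMod 3) W / 2 ^ Fintype.card ι := by
  classical
  let v : ι → Module.Dual (ZMod 3) W := fun i => (LinearMap.proj i).comp W.subtype
  obtain ⟨κ, a, ha, hspan, hli⟩ := exists_linearIndependent' (ZMod 3) v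
  have : Fintype κ := Fintype.ofInjective a ha
  have hcard : Fintype.card κ ≤ Module.finrank (ZMod 3) W := by
    rw [← Subspace.dual_finrank_eq]
    exact hli.fintype_card_le_finrank
  have hinj : ∀ w : W, (∀ j, (w : ι → ZMod 3) (a j) = 0) → w = 0 := by
    intro w hw
    have hker : Submodule.span (ZMod 3) (Set.range (v ∘ a)) ≤
        LinearMap.ker (Module.Dual.eval (ZMod 3) W w) := by
      rw [Submodule.span_le]
      rintro _ ⟨j, rfl⟩
      exact hw j
    rw [hspan, Submodule.span_le] at hker
    ext i
    exact hker ⟨i, rfl⟩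
  rw [pr_eq_card]
  simp only [Fintype.card_pi, Fintype.card_bool, prod_const, card_univ, Nat.cast_pow,
    Nat.cast_ofNat]
  gcongr
  calc (#{ε : ι → Bool | signVec ε ∈ W} : ℝ) ≤ (#(univ : Finset (κ → Bool)) : ℝ) := by
        norm_cast
        refine card_le_card_of_injOn (fun ε => ε ∘ a) (fun _ _ => mem_univ _) ?_
        intro ε hε ε' hε' h
        simp only [coe_filter, mem_univ, true_and, Set.mem_ofPred_eq] at hε hε'
        have h0 := hinj (⟨signVec ε, hε⟩ - ⟨signVec ε', hε'⟩) fun j => by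
          have : ε (a j) = ε' (a j) := congrFun h j
          simp [signVec, this]
        rw [sub_eq_zero, Subtype.mk.injEq] at h0
        ext1 i
        exact sgn_cast_injective (congrFun h0 i)
    _ = 2 ^ Fintype.card κ := by simp
    _ ≤ 2 ^ Module.finrank (ZMod 3) W := by gcongr; norm_num

/-- The rank modulo three of a family of sign vectors. -/
noncomputable def signRank {ι τ : Type*} (E : τ → ι → Bool) : ℕ :=
  Module.finrank (ZMod 3) (Submodule.span (ZMod 3) (Set.range fun t => signVec (E t)))

lemma expect_pow_signRank_le {ι : Type*} [Fintype ι] [DecidableEq ι] {θ : ℝ} (h0 : 0 ≤ θ)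
    (h1 : θ ≤ 1) {m M : ℕ} (hm : m ≤ M) :
    𝔼 E : Fin m → ι → Bool, θ ^ signRank E ≤ (θ + 2 ^ M / 2 ^ Fintype.card ι) ^ m := by
  classical
  induction m with
  | zero =>
    refine expect_le univ_nonempty fun E _ => ?_
    rw [pow_zero]
    exact pow_le_one₀ h0 h1
  | succ m ih =>
    rw [← Fintype.expect_equiv (Fin.consEquiv fun _ => ι → Bool)
      (fun p => θ ^ signRank (Fin.cons p.1 p.2 : Fin (m + 1) → ι → Bool)) _ fun _ => rfl,
      ← univ_product_univ, expect_product, expect_comm, pow_succ]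
    calc _ ≤ 𝔼 E : Fin m → ι → Bool, θ ^ signRank E * (θ + 2 ^ M / 2 ^ Fintype.card ι) := by
          refine expect_le_expect fun E _ => ?_
          set W := Submodule.span (ZMod 3) (Set.range fun t => signVec (E t)) with hW
          have hrank : Module.finrank (ZMod 3) W = signRank E := rfl
          have hle : signRank E ≤ M := by
            have := finrank_range_le_card (R := ZMod 3) fun t => signVec (E t)
            simp only [Fintype.card_fin] at this
            exact this.trans (by omega)
          have hodl := pr_signVec_mem_le W
          calc _ ≤ 𝔼 ε : ι → Bool, θ ^ signRank E *
                (θ + if signVec ε ∈ W then (1 : ℝ) else 0) := by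
                refine expect_le_expect fun ε _ => ?_
                have hrange : (Set.range fun t => signVec ((Fin.cons ε E :
                    Fin (m + 1) → ι → Bool) t)) =
                    insert (signVec ε) (Set.range fun t => signVec (E t)) := by
                  rw [← Fin.range_cons]
                  congr 1
                  ext t i
                  refine Fin.cases ?_ (fun t => ?_) t <;> simp
                split_ifs with hmem
                · have : signRank E ≤ signRank (Fin.cons ε E : Fin (m + 1) → ι → Bool) := by
                    unfold signRank
                    rw [hrange]
                    exact Submodule.finrank_mono (Submodule.span_mono (Set.subset_insert _ _))
                  calc _ ≤ θ ^ signRank E := pow_le_pow_of_le_one h0 h1 this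
                    _ ≤ _ := le_mul_of_one_le_right (by positivity) (by linarith)
                · have : signRank E + 1 ≤
                      signRank (Fin.cons ε E : Fin (m + 1) → ι → Bool) := by
                    unfold signRank
                    rw [hrange]
                    refine Submodule.finrank_lt_finrank_of_lt (lt_of_le_of_ne
                      (Submodule.span_mono (Set.subset_insert _ _)) fun h => hmem ?_)
                    rw [hW, h]
                    exact Submodule.subset_span (Set.mem_insert _ _)
                  calc _ ≤ θ ^ (signRank E + 1) := pow_le_pow_of_le_one h0 h1 this
                    _ = _ := by ring
            _ = θ ^ signRank E * (θ + pr fun ε : ι → Bool => signVec ε ∈ W) := by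
                rw [← mul_expect, expect_add_distrib, Fintype.expect_const, pr]
            _ ≤ _ := by
                gcongr
                refine hodl.trans ?_
                rw [hrank]
                gcongr
                norm_num
      _ ≤ _ := by
          rw [← expect_mul]
          gcongr
          exact ih (by omega)

/-! ### Joint uniformity of independent signed sums -/

lemma expect_comp_of_surjective {G H : Type*} [AddCommGroup G] [Fintype G] [AddCommGroup H]
    [Fintype H] (φ : G →+ H) (hφ : Function.Surjective φ) (f : H → ℝ) :
    𝔼 x, f (φ x) = 𝔼 y, f y := by
  have h1 : ∀ y, 𝔼 x, f (φ x) = 𝔼 x, f (φ x + y) := fun y => by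
    obtain ⟨z, rfl⟩ := hφ y
    exact (Fintype.expect_equiv (Equiv.addRight z) _ _ fun x => by simp).symm
  have h2 : ∀ x, 𝔼 y, f (φ x + y) = 𝔼 y, f y := fun x =>
    Fintype.expect_equiv (Equiv.addLeft (φ x)) _ _ fun _ => rfl
  calc 𝔼 x, f (φ x) = 𝔼 _y : H, 𝔼 x, f (φ x) := (Fintype.expect_const _).symm
    _ = 𝔼 y, 𝔼 x, f (φ x + y) := expect_congr rfl fun y _ => h1 y
    _ = 𝔼 x, 𝔼 y, f (φ x + y) := expect_comm _ _ _
    _ = 𝔼 y, f y := by simp [h2]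

lemma isUnit_intCast_zmod_pow {k : ℕ} (hk : k ≠ 0) (a : ℤ) :
    IsUnit (a : ZMod (3 ^ k)) ↔ (a : ZMod 3) ≠ 0 := by
  rw [Ne, ZMod.intCast_zmod_eq_zero_iff_dvd, ZMod.coe_int_isUnit_iff_isCoprime]
  push_cast
  rw [IsCoprime.pow_left_iff (Nat.pos_of_ne_zero hk), Int.isCoprime_iff_gcd_eq_one]
  have : Nat.Prime (Int.natAbs 3) := by norm_num
  rw [Int.gcd, ← Nat.Coprime, this.coprime_iff_not_dvd, Int.natAbs_dvd_natAbs]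

lemma mulVec_surjective_of_linearIndependent {ι τ : Type*} [Fintype ι] [Fintype τ]
    [DecidableEq ι] [DecidableEq τ] {k : ℕ} (hk : k ≠ 0) (A : Matrix τ ι ℤ)
    (hA : LinearIndependent (ZMod 3) fun t i => (A t i : ZMod 3)) :
    Function.Surjective (A.map (Int.cast : ℤ → ZMod (3 ^ k))).mulVec := by
  obtain ⟨g, hg⟩ := LinearMap.exists_leftInverse_of_injective _
    (LinearMap.ker_eq_bot.mpr (linearIndependent_iff_injective_fintypeLinearCombination.mp hA))
  have hgt : ∀ t, g (fun i => (A t i : ZMod 3)) = Pi.single t 1 := fun t => by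
    have := LinearMap.congr_fun hg (Pi.single t 1)
    simpa [Fintype.linearCombination_apply_single] using this
  obtain ⟨C, hC⟩ : ∃ C : Matrix ι τ ℤ, ∀ i t, (C i t : ZMod 3) = g (Pi.single i 1) t :=
    ⟨Matrix.of fun i t => ((g (Pi.single i 1) t).val : ℤ), fun i t => by simp⟩
  have hAC : (A * C).map (Int.cast : ℤ → ZMod 3) = 1 := by
    ext t t'
    have h1 : ((fun i => (A t i : ZMod 3)) : ι → ZMod 3) =
        ∑ i, (A t i : ZMod 3) • Pi.single i 1 := by
      ext j
      simp [Finset.sum_apply, Pi.single_apply]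
    have h2 := congrFun (hgt t) t'
    rw [h1, map_sum] at h2
    simp only [map_smul, Finset.sum_apply, Pi.smul_apply, smul_eq_mul] at h2
    simp only [Matrix.map_apply, Matrix.mul_apply, Int.cast_sum, Int.cast_mul, hC]
    rw [h2, Matrix.one_apply, Pi.single_apply]
    simp [eq_comm]
  have hdet : IsUnit ((A * C).map (Int.cast : ℤ → ZMod (3 ^ k))).det := by
    have e1 : ((A * C).map (Int.cast : ℤ → ZMod (3 ^ k))).det = ((A * C).det : ℤ) :=
      (RingHom.map_det (Int.castRingHom (ZMod (3 ^ k))) (A * C)).symm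
    have e2 : ((A * C).map (Int.cast : ℤ → ZMod 3)).det = ((A * C).det : ℤ) :=
      (RingHom.map_det (Int.castRingHom (ZMod 3)) (A * C)).symm
    rw [e1, isUnit_intCast_zmod_pow hk, ← e2, hAC, Matrix.det_one]
    exact one_ne_zero
  have hmul : (A * C).map (Int.cast : ℤ → ZMod (3 ^ k)) =
      A.map (Int.cast : ℤ → ZMod (3 ^ k)) * C.map (Int.cast : ℤ → ZMod (3 ^ k)) :=
    Matrix.map_mul (f := Int.castRingHom (ZMod (3 ^ k)))
  rw [Matrix.mulVec_surjective_iff_exists_right_inverse]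
  refine ⟨C.map (Int.cast : ℤ → ZMod (3 ^ k)) *
    ((A * C).map (Int.cast : ℤ → ZMod (3 ^ k)))⁻¹, ?_⟩
  rw [← Matrix.mul_assoc, ← hmul, Matrix.mul_nonsing_inv _ hdet]

/-- The moment bound: high moments of the probability that a random signed sum lands in `D`. -/
lemma expect_walk_pow_le {ι : Type*} [Fintype ι] [DecidableEq ι] {k : ℕ} (hk : k ≠ 0)
    (p : ZMod (3 ^ k) → Prop) [DecidablePred p] {θ : ℝ} (hθ : pr p ≤ θ) (hθ1 : θ ≤ 1) (m : ℕ)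
    (z : ZMod (3 ^ k)) :
    𝔼 x : ι → ZMod (3 ^ k), walk x (fun y => if p y then (1 : ℝ) else 0) z ^ m ≤
      (θ + 2 ^ m / 2 ^ Fintype.card ι) ^ m := by
  classical
  have hθ0 : 0 ≤ θ := (pr_nonneg p).trans hθ
  simp only [walk, expect_pow, Fintype.piFinset_univ]
  rw [expect_comm]
  refine le_trans (expect_le_expect fun E _ => ?_)
    (expect_pow_signRank_le hθ0 hθ1 le_rfl)
  obtain ⟨κ, a, ha, hspan, hli⟩ :=
    exists_linearIndependent' (ZMod 3) fun t => signVec (E t)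
  have : Fintype κ := Fintype.ofInjective a ha
  have hrank : signRank E = Fintype.card κ := by
    rw [signRank, ← hspan, finrank_span_eq_card hli]
  let A : Matrix κ ι ℤ := fun j i => sgn (E (a j) i)
  have hsurj := mulVec_surjective_of_linearIndependent hk A hli
  let φ : (ι → ZMod (3 ^ k)) →+ (κ → ZMod (3 ^ k)) :=
    (Matrix.mulVecLin (A.map (Int.cast : ℤ → ZMod (3 ^ k)))).toAddMonoidHom
  have hφ : ∀ x j, φ x j = signSum (E (a j)) x := fun x j => rfl
  calc _ ≤ 𝔼 x : ι → ZMod (3 ^ k), ∏ j, (if p (z + φ x j) then (1 : ℝ) else 0) := by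
        refine expect_le_expect fun x _ => ?_
        by_cases h : ∀ j, p (z + φ x j)
        · simp only [h, if_true, prod_const_one]
          exact prod_le_one (fun _ _ => by split_ifs <;> norm_num)
            fun _ _ => by split_ifs <;> norm_num
        · obtain ⟨j, hj⟩ := not_forall.mp h
          rw [prod_eq_zero (mem_univ (a j)) (if_neg (by rwa [hφ] at hj))]
          exact prod_nonneg fun _ _ => by split_ifs <;> norm_num
    _ = 𝔼 y : κ → ZMod (3 ^ k), ∏ j, (if p (z + y j) then (1 : ℝ) else 0) :=
        expect_comp_of_surjective φ hsurj
          fun y => ∏ j, (if p (z + y j) then (1 : ℝ) else 0)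
    _ = ∏ _j : κ, 𝔼 w : ZMod (3 ^ k), (if p (z + w) then (1 : ℝ) else 0) :=
        expect_pi_prod fun _ w => if p (z + w) then (1 : ℝ) else 0
    _ = pr p ^ Fintype.card κ := by
        rw [prod_const, card_univ]
        congr 1
        rw [pr]
        exact Fintype.expect_equiv (Equiv.addLeft z) _ _ fun w => by simp; congr
    _ ≤ θ ^ signRank E := by
        rw [hrank]
        gcongr
        exact pr_nonneg p

/-! ### Fourier weights on cyclic groups -/

section Fourier

variable {N : ℕ} [NeZero N]

/-- The `r`-th Fourier coefficient of `g`. -/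
noncomputable def fourierCoeff (g : ZMod N → ℂ) (r : ZMod N) : ℂ :=
  𝔼 z, g z * ZMod.stdAddChar (z * r)

lemma sum_norm_fourierCoeff_sq (g : ZMod N → ℂ) :
    ∑ r, ‖fourierCoeff g r‖ ^ 2 = 𝔼 z, ‖g z‖ ^ 2 := by
  have key : (∑ r, fourierCoeff g r * conj (fourierCoeff g r) : ℂ) =
      𝔼 z, g z * conj (g z) := by
    calc (∑ r, fourierCoeff g r * conj (fourierCoeff g r) : ℂ)
        = ∑ r, 𝔼 z, 𝔼 y, g z * conj (g y) * ZMod.stdAddChar (r * (z - y)) := by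
          refine sum_congr rfl fun r _ => ?_
          simp only [fourierCoeff, map_expect]
          rw [expect_mul_expect]
          refine expect_congr rfl fun z _ => expect_congr rfl fun y _ => ?_
          rw [map_mul (starRingEnd ℂ), ← AddChar.map_neg_eq_conj, show r * (z - y) = z * r + -(y * r) by ring,
            AddChar.map_add_eq_mul]
          ring
      _ = 𝔼 z, 𝔼 y, g z * conj (g y) * ∑ r, ZMod.stdAddChar (r * (z - y)) := by
          rw [← expect_sum_comm]
          refine expect_congr rfl fun z _ => ?_
          rw [← expect_sum_comm]
          refine expect_congr rfl fun y _ => ?_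
          rw [mul_sum]
      _ = 𝔼 z, g z * conj (g z) := by
          refine expect_congr rfl fun z _ => ?_
          simp only [AddChar.sum_mulShift _ (ZMod.isPrimitive_stdAddChar N), sub_eq_zero,
            ZMod.card]
          rw [Fintype.expect_eq_sum_div_card]
          have hN : (N : ℂ) ≠ 0 := Nat.cast_ne_zero.mpr (NeZero.ne N)
          simp [ZMod.card, hN]
  apply Complex.ofReal_injective
  push_cast
  simpa only [Complex.mul_conj, Complex.normSq_eq_norm_sq, Complex.ofReal_pow] using key

/-- The squared modulus of the `r`-th Fourier coefficient of a real function. -/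
noncomputable def weight (f : ZMod N → ℝ) (r : ZMod N) : ℝ :=
  ‖fourierCoeff (fun z => (f z : ℂ)) r‖ ^ 2

lemma weight_nonneg (f : ZMod N → ℝ) (r : ZMod N) : 0 ≤ weight f r := by
  unfold weight; positivity

lemma sum_weight (f : ZMod N → ℝ) : ∑ r, weight f r = 𝔼 z, f z ^ 2 := by
  simpa [weight] using sum_norm_fourierCoeff_sq fun z => (f z : ℂ)

lemma weight_zero (f : ZMod N → ℝ) : weight f 0 = (𝔼 z, f z) ^ 2 := by
  simp [weight, fourierCoeff, ← Complex.ofReal_expect]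

lemma weight_le_one {f : ZMod N → ℝ} (hf : ∀ z, 0 ≤ f z) (h1 : 𝔼 z, f z = 1) (r : ZMod N) :
    weight f r ≤ 1 := by
  have : ‖fourierCoeff (fun z => (f z : ℂ)) r‖ ≤ 1 := by
    rw [← h1, fourierCoeff]
    refine (RCLike.norm_expect_le (K := ℝ)).trans_eq (expect_congr rfl fun z _ => ?_)
    simp [abs_of_nonneg (hf z)]
  exact pow_le_one₀ (norm_nonneg _) this

lemma sum_weight_erase_zero {f : ZMod N → ℝ} (h1 : 𝔼 z, f z = 1) :
    ∑ r ∈ univ.erase 0, weight f r = 𝔼 z, (f z - 1) ^ 2 := by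
  have h := sum_weight f
  rw [← add_sum_erase _ _ (mem_univ (0 : ZMod N)), weight_zero, h1] at h
  have : 𝔼 z, (f z - 1) ^ 2 = 𝔼 z, f z ^ 2 - 2 * 𝔼 z, f z + 1 := by
    simp only [sub_sq, one_pow, mul_one]
    rw [expect_add_distrib, expect_sub_distrib, ← mul_expect, Fintype.expect_const]
  rw [this, h1]
  linarith

/-- The squared cosine attached to a frequency. -/
noncomputable def cosSq (y : ZMod N) : ℝ := (ZMod.stdAddChar y).re ^ 2

lemma cosSq_nonneg (y : ZMod N) : 0 ≤ cosSq y := sq_nonneg _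

lemma cosSq_eq (y : ZMod N) : cosSq y = (1 + (ZMod.stdAddChar (2 * y) : ℂ).re) / 2 := by
  have h : (ZMod.stdAddChar y : ℂ).re ^ 2 + (ZMod.stdAddChar y : ℂ).im ^ 2 = 1 := by
    have : ‖(ZMod.stdAddChar y : ℂ)‖ ^ 2 = 1 := by simp
    rw [← Complex.normSq_eq_norm_sq, Complex.normSq_apply] at this
    linarith
  rw [two_mul, AddChar.map_add_eq_mul, Complex.mul_re, cosSq]
  linarith

lemma cosSq_le_one (y : ZMod N) : cosSq y ≤ 1 := by
  have : (ZMod.stdAddChar (2 * y) : ℂ).re ≤ 1 := (Complex.re_le_norm _).trans (by simp)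
  rw [cosSq_eq]
  linarith

variable {ι : Type*} [Fintype ι] [DecidableEq ι]

lemma expect_stdAddChar_signSum (x : ι → ZMod N) (r : ZMod N) :
    𝔼 ε : ι → Bool, (ZMod.stdAddChar (-(signSum ε x * r)) : ℂ) =
      ∏ i, ((ZMod.stdAddChar (r * x i) : ℂ).re : ℂ) := by
  have h : ∀ ε : ι → Bool, (ZMod.stdAddChar (-(signSum ε x * r)) : ℂ) =
      ∏ i, (ZMod.stdAddChar (-((sgn (ε i) : ZMod N) * x i * r)) : ℂ) := fun ε => by
    rw [signSum, sum_mul, ← sum_neg_distrib]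
    exact map_prod (ZMod.stdAddChar (N := N)).toMonoidHom
      (fun i => Multiplicative.ofAdd (-((sgn (ε i) : ZMod N) * x i * r))) univ
  simp only [h]
  rw [expect_pi_prod fun i b => (ZMod.stdAddChar (-((sgn b : ZMod N) * x i * r)) : ℂ)]
  refine prod_congr rfl fun i _ => ?_
  rw [Fintype.expect_eq_sum_div_card]
  simp only [Fintype.sum_bool, sgn, cond_true, cond_false, Fintype.card_bool]
  push_cast
  rw [Complex.re_eq_add_conj, ← AddChar.map_neg_eq_conj, add_comm]
  ring_nf

lemma weight_walk (x : ι → ZMod N) (f : ZMod N → ℝ) (r : ZMod N) :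
    weight (walk x f) r = weight f r * ∏ i, cosSq (r * x i) := by
  have h : fourierCoeff (fun z => (walk x f z : ℂ)) r =
      fourierCoeff (fun z => (f z : ℂ)) r * ∏ i, ((ZMod.stdAddChar (r * x i) : ℂ).re : ℂ) := by
    have shift : ∀ t : ZMod N, 𝔼 z, (f (z + t) : ℂ) * (ZMod.stdAddChar (z * r) : ℂ) =
        fourierCoeff (fun z => (f z : ℂ)) r * (ZMod.stdAddChar (-(t * r)) : ℂ) := fun t => by
      rw [fourierCoeff, expect_mul]
      refine Fintype.expect_equiv (Equiv.addRight t)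
        (fun z => (f (z + t) : ℂ) * (ZMod.stdAddChar (z * r) : ℂ))
        (fun z => (f z : ℂ) * (ZMod.stdAddChar (z * r) : ℂ) * (ZMod.stdAddChar (-(t * r)) : ℂ))
        fun z => ?_
      rw [Equiv.coe_addRight, mul_assoc, ← AddChar.map_add_eq_mul]
      congr 2
      ring
    rw [← expect_stdAddChar_signSum, mul_expect]
    simp only [← shift]
    rw [expect_comm]
    simp only [fourierCoeff, walk, Complex.ofReal_expect, expect_mul]
  rw [weight, h, norm_mul, mul_pow, norm_prod, ← prod_pow]
  simp [weight, cosSq]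

end Fourier

/-! ### Squared cosines along random multiples of a frequency -/

section Cosine

variable {N : ℕ} [NeZero N]

lemma gcd_dvd_valMinAbs_mul (c x : ZMod N) : (Nat.gcd c.val N : ℤ) ∣ (c * x).valMinAbs := by
  have h : (N : ℤ) ∣ (c * x).valMinAbs - c.val * x.val := by
    rw [← ZMod.intCast_zmod_eq_zero_iff_dvd]
    simp
  have h1 : (Nat.gcd c.val N : ℤ) ∣ (c * x).valMinAbs - c.val * x.val :=
    (Int.natCast_dvd_natCast.mpr (Nat.gcd_dvd_right _ _)).trans h
  have h2 : (Nat.gcd c.val N : ℤ) ∣ c.val * x.val :=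
    (Int.natCast_dvd_natCast.mpr (Nat.gcd_dvd_left _ _)).mul_right _
  simpa using dvd_add h1 h2

lemma card_mul_eq_zero_le (c : ZMod N) : #{x : ZMod N | c * x = 0} ≤ Nat.gcd c.val N := by
  have hd : 0 < Nat.gcd c.val N := Nat.gcd_pos_of_pos_right _ (NeZero.pos N)
  refine le_trans (card_le_card fun x hx => ?_)
    (IsAddCyclic.card_nsmul_eq_zero_le (α := ZMod N) hd)
  simp only [mem_filter, mem_univ, true_and] at hx ⊢
  have h := congrArg (Int.cast : ℤ → ZMod N) (Nat.gcd_eq_gcd_ab c.val N)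
  push_cast at h
  rw [nsmul_eq_mul, h]
  simp only [ZMod.natCast_val, ZMod.cast_id', id_eq, CharP.cast_eq_zero, zero_mul, add_zero]
  rw [mul_right_comm, hx, zero_mul]

lemma card_natAbs_valMinAbs_mul_le (c : ZMod N) (T : ℕ) :
    #{x : ZMod N | c * x ≠ 0 ∧ (c * x).valMinAbs.natAbs ≤ T} ≤ 2 * T := by
  set d := Nat.gcd c.val N with hd_def
  have hd : 0 < d := Nat.gcd_pos_of_pos_right _ (NeZero.pos N)
  have key := card_le_mul_card_image_of_maps_to
    (s := ({x : ZMod N | c * x ≠ 0 ∧ (c * x).valMinAbs.natAbs ≤ T} : Finset (ZMod N)))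
    (f := fun x => (c * x).valMinAbs / (d : ℤ))
    (t := (Icc (-((T / d : ℕ) : ℤ)) ((T / d : ℕ) : ℤ)).erase 0) ?_ d ?_
  · refine key.trans ?_
    rw [card_erase_of_mem (by simp; positivity), Int.card_Icc]
    have h1 : ((((T / d : ℕ) : ℤ) + 1 - -((T / d : ℕ) : ℤ)).toNat - 1) = 2 * (T / d) := by omega
    rw [h1]
    calc d * (2 * (T / d)) = 2 * (d * (T / d)) := by ring
      _ ≤ 2 * T := by gcongr; exact Nat.mul_div_le T d
  · intro x hx
    simp only [mem_filter, mem_univ, true_and] at hx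
    obtain ⟨w, hw⟩ := gcd_dvd_valMinAbs_mul c x
    rw [← hd_def] at hw
    have hd' : (d : ℤ) ≠ 0 := by exact_mod_cast hd.ne'
    have hdiv : (c * x).valMinAbs / (d : ℤ) = w := by rw [hw, Int.mul_ediv_cancel_left _ hd']
    have hwT : w.natAbs ≤ T / d := by
      rw [Nat.le_div_iff_mul_le hd, mul_comm]
      have := hx.2
      rwa [hw, Int.natAbs_mul, Int.natAbs_natCast] at this
    have hw0 : w ≠ 0 := fun h => hx.1 (by
      rw [← ZMod.valMinAbs_eq_zero, hw, h, mul_zero])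
    rw [hdiv, mem_erase, mem_Icc]
    omega
  · intro b _
    by_cases hne : ∃ x₀ : ZMod N, (c * x₀).valMinAbs / (d : ℤ) = b
    · obtain ⟨x₀, hx₀⟩ := hne
      refine le_trans (card_le_card_of_injOn (fun x => x - x₀) (t := {x : ZMod N | c * x = 0})
        (fun x hx => ?_) fun x _ y _ h => by simpa using h) (card_mul_eq_zero_le c)
      simp only [coe_filter, mem_filter, mem_univ, true_and, Set.mem_ofPred_eq] at hx ⊢
      have := hx.2.trans hx₀.symm
      rw [Int.ediv_left_inj (gcd_dvd_valMinAbs_mul c x) (gcd_dvd_valMinAbs_mul c x₀),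
        ZMod.valMinAbs_inj] at this
      rw [mul_sub, this, sub_self]
    · rw [filter_false_of_mem fun x _ h => hne ⟨x, h⟩]
      simp

lemma cosSq_le (y : ZMod N) :
    cosSq y ≤ 1 - 4 * (((2 * y).valMinAbs.natAbs : ℝ) / N) ^ 2 := by
  have hN : (0 : ℝ) < N := Nat.cast_pos.mpr (NeZero.pos N)
  set w := (2 * y).valMinAbs with hw
  have hre : (ZMod.stdAddChar (2 * y) : ℂ).re = Real.cos (2 * (Real.pi * w / N)) := by
    rw [← ZMod.coe_valMinAbs (2 * y), ZMod.stdAddChar_coe, ← hw,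
      show (2 * (Real.pi : ℂ) * Complex.I * (w : ℂ) / (N : ℂ)) =
        ((2 * (Real.pi * w / N) : ℝ) : ℂ) * Complex.I by push_cast; ring,
      Complex.exp_ofReal_mul_I_re]
  have habs : (w.natAbs : ℝ) = |(w : ℝ)| := by
    rw [← Int.cast_abs, Int.abs_eq_natAbs, Int.cast_natCast]
  have hle : (w.natAbs : ℝ) / N ≤ 1 / 2 := by
    have := ZMod.natAbs_valMinAbs_le (2 * y)
    rw [← hw, Nat.le_div_two_iff_mul_two_le] at this
    rw [div_le_div_iff₀ hN two_pos]
    have h' : ((w.natAbs * 2 : ℕ) : ℝ) ≤ N := by exact_mod_cast this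
    push_cast at h' ⊢
    linarith
  have hsin := Real.mul_le_sin (x := Real.pi * (w.natAbs / N)) (by positivity)
    (by nlinarith [Real.pi_pos])
  have hsin' : 2 * ((w.natAbs : ℝ) / N) ≤ Real.sin (Real.pi * (w.natAbs / N)) := by
    refine le_trans (le_of_eq ?_) hsin
    field_simp
  have hsq : Real.sin (Real.pi * (w.natAbs / N)) ^ 2 = Real.sin (Real.pi * w / N) ^ 2 := by
    rw [habs]
    rcases abs_choice (w : ℝ) with h | h
    · rw [h, mul_div_assoc]
    · rw [h, neg_div, mul_neg, Real.sin_neg, neg_sq, mul_div_assoc]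
  rw [cosSq_eq, hre, Real.cos_two_mul, Real.cos_sq', ← hsq]
  have h0 : (0 : ℝ) ≤ (w.natAbs : ℝ) / N := by positivity
  nlinarith

/-- High moments of the squared cosines are uniformly small. -/
lemma exists_expect_cosSq_pow_le {κ : ℝ} (hκ : 0 < κ) :
    ∃ b : ℕ, ∀ (N : ℕ) [NeZero N], Odd N → ∀ r : ZMod N, r ≠ 0 →
      𝔼 x : ZMod N, (if IsUnit x then cosSq (r * x) ^ b else 0) ≤ κ := by
  set t : ℝ := min (κ / 4) (1 / 4) with ht_def
  have ht0 : 0 < t := by positivity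
  have ht1 : t ≤ 1 / 4 := min_le_right _ _
  obtain ⟨b, hb⟩ := exists_pow_lt_of_lt_one (x := κ / 2) (y := 1 - 4 * t ^ 2) (by positivity)
    (by nlinarith)
  refine ⟨b, fun N _ hodd r hr => ?_⟩
  have hN : (0 : ℝ) < N := Nat.cast_pos.mpr (NeZero.pos N)
  have h2 : IsUnit (2 : ZMod N) := by
    have := (ZMod.isUnit_iff_coprime 2 N).mpr (Nat.coprime_two_left.mpr hodd)
    simpa using this
  let D : Finset (ZMod N) :=
    {x | 2 * r * x ≠ 0 ∧ (2 * r * x).valMinAbs.natAbs ≤ ⌊t * N⌋₊}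
  have hpt : ∀ x : ZMod N, (if IsUnit x then cosSq (r * x) ^ b else 0) ≤
      (if x ∈ D then (1 : ℝ) else 0) + κ / 2 := fun x => by
    by_cases hx : IsUnit x
    · rw [if_pos hx]
      by_cases hD : x ∈ D
      · rw [if_pos hD]
        have := pow_le_one₀ (n := b) (cosSq_nonneg (r * x)) (cosSq_le_one (r * x))
        linarith
      · rw [if_neg hD, zero_add]
        refine le_trans (pow_le_pow_left₀ (cosSq_nonneg _) ((cosSq_le _).trans ?_) b) hb.le
        have hne : 2 * r * x ≠ 0 := by
          rw [mul_assoc, Ne, h2.mul_right_eq_zero, hx.mul_left_eq_zero]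
          exact hr
        have hgt : ⌊t * N⌋₊ < (2 * r * x).valMinAbs.natAbs := by
          by_contra hcon
          exact hD (by simp only [D, mem_filter, mem_univ, true_and]; exact ⟨hne, not_lt.mp hcon⟩)
        have hgt' := (Nat.lt_of_floor_lt hgt).le
        rw [← mul_assoc]
        have : t ≤ ((2 * r * x).valMinAbs.natAbs : ℝ) / N := by rwa [le_div_iff₀ hN]
        nlinarith
    · rw [if_neg hx]
      split_ifs <;> positivity
  refine (expect_le_expect fun x _ => hpt x).trans ?_
  rw [expect_add_distrib, Fintype.expect_const, Fintype.expect_eq_sum_div_card, sum_boole,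
    filter_mem_eq_inter, univ_inter, ZMod.card]
  have hcard : (#D : ℝ) ≤ 2 * (t * N) := by
    have h1 : #D ≤ 2 * ⌊t * N⌋₊ := card_natAbs_valMinAbs_mul_le (2 * r) _
    have h2 := Nat.floor_le (a := t * N) (by positivity)
    calc (#D : ℝ) ≤ ((2 * ⌊t * N⌋₊ : ℕ) : ℝ) := by exact_mod_cast h1
      _ ≤ _ := by push_cast; linarith
  have : (#D : ℝ) / N ≤ 2 * t := by
    rw [div_le_iff₀ hN]; linarith
  have ht2 : t ≤ κ / 4 := min_le_left _ _
  linarith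

end Cosine

/-! ### Flattening the density of a random walk -/

section Stages

lemma pr_lt_le_pow_div {α : Type*} [Fintype α] {f : α → ℝ} (hf : ∀ a, 0 ≤ f a) {c : ℝ}
    (hc : 0 < c) (m : ℕ) : pr (fun a => c < f a) ≤ (𝔼 a, f a ^ m) / c ^ m := by
  rw [expect_div]
  refine expect_le_expect fun a _ => ?_
  have := hf a
  split_ifs with h
  · rw [one_le_div (by positivity)]
    exact pow_le_pow_left₀ hc.le h.le m
  · positivity

/-- The density of the point mass at zero with respect to the uniform distribution. -/
noncomputable def pointDensity (N : ℕ) (z : ZMod N) : ℝ := if z = 0 then (N : ℝ) else 0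

lemma pointDensity_nonneg {N : ℕ} (z : ZMod N) : 0 ≤ pointDensity N z := by
  unfold pointDensity; split_ifs <;> positivity

lemma expect_pointDensity {N : ℕ} [NeZero N] : 𝔼 z, pointDensity N z = 1 := by
  have hN : (N : ℝ) ≠ 0 := Nat.cast_ne_zero.mpr (NeZero.ne N)
  rw [Fintype.expect_eq_sum_div_card]
  simp [pointDensity, ZMod.card, hN]

variable {ι : Type*} [Fintype ι] [DecidableEq ι]

/-- Roughly uniform boundedness of the density after a long walk. -/
lemma pr_exists_walk_pointDensity_le {k : ℕ} (hk : k ≠ 0) {s n : ℕ}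
    (hι : Fintype.card ι + 4 * s = n) (hq : 3 ^ k * 2 ^ (5 * s) ≤ 2 ^ n) {H : ℝ} (hH : 0 < H) :
    pr (fun x : ι → ZMod (3 ^ k) => ∃ z, H < walk x (pointDensity (3 ^ k)) z) ≤
      3 ^ k * (2 / H) ^ s := by
  have hq0 : (0 : ℝ) < 3 ^ k := by positivity
  set p : ZMod (3 ^ k) → Prop := fun y => y = 0 with hp
  have hpr : pr p = 1 / 3 ^ k := by
    refine (pr_eq_card fun y : ZMod (3 ^ k) => y = 0).trans ?_
    simp [filter_eq', ZMod.card]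
  have hwalk : ∀ (x : ι → ZMod (3 ^ k)) z, walk x (pointDensity (3 ^ k)) z =
      3 ^ k * walk x (fun y => if p y then (1 : ℝ) else 0) z := fun x z => by
    simp only [walk, mul_expect, pointDensity, hp, Nat.cast_pow, Nat.cast_ofNat]
    refine expect_congr rfl fun ε _ => ?_
    split_ifs <;> simp
  have hnn : ∀ (x : ι → ZMod (3 ^ k)) z, 0 ≤ walk x (fun y => if p y then (1 : ℝ) else 0) z :=
    fun x z => walk_nonneg x (fun y => by split_ifs <;> norm_num) z
  have hsmall : (2 : ℝ) ^ s / 2 ^ Fintype.card ι ≤ 1 / 3 ^ k := by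
    rw [div_le_div_iff₀ (by positivity) hq0, one_mul]
    have h1 : (3 : ℝ) ^ k * 2 ^ (5 * s) ≤ 2 ^ n := by exact_mod_cast hq
    rw [← hι, pow_add, show 5 * s = s + 4 * s by ring, pow_add, ← mul_assoc] at h1
    have := le_of_mul_le_mul_right h1 (by positivity)
    linarith
  have hz : ∀ z, pr (fun x : ι → ZMod (3 ^ k) => H < walk x (pointDensity (3 ^ k)) z) ≤
      (2 / H) ^ s := fun z => by
    calc _ ≤ pr (fun x : ι → ZMod (3 ^ k) =>
          H / 3 ^ k < walk x (fun y => if p y then (1 : ℝ) else 0) z) := by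
          refine pr_mono fun x hx => ?_
          rw [hwalk] at hx
          rw [div_lt_iff₀ hq0]
          linarith
      _ ≤ _ := pr_lt_le_pow_div (fun x => hnn x z) (by positivity) s
      _ ≤ (1 / 3 ^ k + 2 ^ s / 2 ^ Fintype.card ι) ^ s / (H / 3 ^ k) ^ s := by
          gcongr
          refine expect_walk_pow_le hk p hpr.le ?_ s z
          rw [div_le_one hq0]
          exact one_le_pow₀ (by norm_num)
      _ ≤ (1 / 3 ^ k + 1 / 3 ^ k) ^ s / (H / 3 ^ k) ^ s := by gcongr
      _ = (2 / H) ^ s := by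
          rw [← div_pow]
          congr 1
          field_simp
          norm_num
  calc _ ≤ pr (fun x : ι → ZMod (3 ^ k) =>
        ∃ z ∈ (univ : Finset (ZMod (3 ^ k))), H < walk x (pointDensity (3 ^ k)) z) :=
        pr_mono fun x ⟨z, hz⟩ => ⟨z, mem_univ z, hz⟩
    _ ≤ ∑ z : ZMod (3 ^ k), (2 / H) ^ s := (pr_exists_mem_le _ _).trans
        (sum_le_sum fun z _ => hz z)
    _ = _ := by simp [ZMod.card]

/-- After a further walk with unit steps all non-trivial Fourier weights are small. -/
lemma pr_exists_weight_walk_le {N : ℕ} [NeZero N] {κ : ℝ} (hκ0 : 0 ≤ κ) {b : ℕ}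
    (hb : ∀ r : ZMod N, r ≠ 0 → 𝔼 x : ZMod N, (if IsUnit x then cosSq (r * x) ^ b else 0) ≤ κ)
    {f : ZMod N → ℝ} (hf : ∀ z, 0 ≤ f z) (h1 : 𝔼 z, f z = 1) {H : ℝ} (hH : ∀ z, f z ≤ H)
    {σ : ℝ} (hσ : 0 < σ) :
    pr (fun x : ι → ZMod N => (∀ i, IsUnit (x i)) ∧ ∃ r, r ≠ 0 ∧ σ < weight (walk x f) r) ≤
      H / σ * (κ ^ Fintype.card ι / σ ^ b) := by
  classical
  have hκ : ∀ r : ZMod N, r ≠ 0 → pr (fun x : ι → ZMod N => (∀ i, IsUnit (x i)) ∧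
      σ < ∏ i, cosSq (r * x i)) ≤ κ ^ Fintype.card ι / σ ^ b := fun r hr => by
    have hpt : ∀ x : ι → ZMod N, (if (∀ i, IsUnit (x i)) ∧ σ < ∏ i, cosSq (r * x i)
        then (1 : ℝ) else 0) ≤
        (∏ i, (if IsUnit (x i) then cosSq (r * x i) ^ b else 0)) / σ ^ b := fun x => by
      split_ifs with h
      · rw [prod_congr rfl fun i _ => if_pos (h.1 i), prod_pow, one_le_div (by positivity)]
        exact pow_le_pow_left₀ hσ.le h.2.le b
      · refine div_nonneg (prod_nonneg fun i _ => ?_) (by positivity)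
        split_ifs
        · exact pow_nonneg (cosSq_nonneg _) b
        · exact le_rfl
    calc _ ≤ 𝔼 x : ι → ZMod N,
          (∏ i, (if IsUnit (x i) then cosSq (r * x i) ^ b else 0)) / σ ^ b := by
          rw [pr]
          refine expect_le_expect fun x _ => ?_
          exact le_trans (le_of_eq (by congr)) (hpt x)
      _ ≤ _ := by
          rw [← expect_div, expect_pi_prod fun _ y => if IsUnit y then cosSq (r * y) ^ b else 0]
          gcongr
          rw [prod_const, card_univ]
          refine pow_le_pow_left₀ (expect_nonneg fun y _ => ?_) (hb r hr) _
          split_ifs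
          · exact pow_nonneg (cosSq_nonneg _) b
          · exact le_rfl
  let R : Finset (ZMod N) := {r | r ≠ 0 ∧ σ < weight f r}
  have hR : (#R : ℝ) ≤ H / σ := by
    rw [le_div_iff₀ hσ]
    calc (#R : ℝ) * σ = ∑ r ∈ R, σ := by simp
      _ ≤ ∑ r ∈ R, weight f r := sum_le_sum fun r hr => (mem_filter.mp hr).2.2.le
      _ ≤ ∑ r, weight f r := sum_le_univ_sum_of_nonneg (weight_nonneg f)
      _ = 𝔼 z, f z ^ 2 := sum_weight f
      _ ≤ 𝔼 z, H * f z := expect_le_expect fun z _ => by nlinarith [hf z, hH z]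
      _ = H := by rw [← mul_expect, h1, mul_one]
  have hc0 : ∀ (x : ι → ZMod N) r, 0 ≤ ∏ i, cosSq (r * x i) := fun x r =>
    prod_nonneg fun _ _ => cosSq_nonneg _
  calc _ ≤ pr (fun x : ι → ZMod N => ∃ r ∈ R, (∀ i, IsUnit (x i)) ∧
        σ < ∏ i, cosSq (r * x i)) := by
        refine pr_mono fun x ⟨hx, r, hr, hrσ⟩ => ?_
        rw [weight_walk] at hrσ
        refine ⟨r, ?_, hx, hrσ.trans_le (mul_le_of_le_one_left (hc0 x r)
          (weight_le_one hf h1 r))⟩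
        refine mem_filter.mpr ⟨mem_univ r, hr, hrσ.trans_le (mul_le_of_le_one_right
          (weight_nonneg f r) (prod_le_one (fun _ _ => cosSq_nonneg _)
          fun _ _ => cosSq_le_one _))⟩
    _ ≤ ∑ r ∈ R, κ ^ Fintype.card ι / σ ^ b := (pr_exists_mem_le _ _).trans
        (sum_le_sum fun r hr => hκ r (mem_filter.mp hr).2.1)
    _ = #R * (κ ^ Fintype.card ι / σ ^ b) := by rw [sum_const, nsmul_eq_mul]
    _ ≤ _ := by
        gcongr

/-- A sharp point bound from a mean-square bound. -/
lemma pr_walk_zero_le {k : ℕ} (hk : k ≠ 0) {g : ZMod (3 ^ k) → ℝ}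
    {H : ℝ} (hH0 : 0 < H) (hH : ∀ z, g z ≤ H) {θ : ℝ} (hθ1 : θ ≤ 1)
    (hθ : 𝔼 z, (g z - 1) ^ 2 ≤ θ) {s : ℕ} (hι : Fintype.card ι = 2 * s) :
    pr (fun x : ι → ZMod (3 ^ k) => 3 < walk x g 0) ≤ (H * (θ + 1 / 2 ^ s)) ^ s := by
  classical
  set p : ZMod (3 ^ k) → Prop := fun z => 2 < g z with hp
  have hpr : pr p ≤ θ := by
    refine le_trans ?_ hθ
    refine expect_le_expect fun z _ => ?_
    split_ifs with h
    · nlinarith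
    · positivity
  have hw : ∀ x : ι → ZMod (3 ^ k),
      walk x g 0 ≤ 2 + H * walk x (fun y => if p y then (1 : ℝ) else 0) 0 := fun x => by
    calc walk x g 0 ≤ walk x (fun y => 2 + H * (if p y then (1 : ℝ) else 0)) 0 := by
          refine walk_mono x (fun z => ?_) 0
          split_ifs with h
          · linarith [hH z]
          · simpa using not_lt.mp h
      _ = _ := by
          simp only [walk]
          rw [expect_add_distrib, Fintype.expect_const, mul_expect]
  calc _ ≤ pr (fun x : ι → ZMod (3 ^ k) =>
        1 / H < walk x (fun y => if p y then (1 : ℝ) else 0) 0) := by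
        refine pr_mono fun x hx => ?_
        rw [div_lt_iff₀ hH0]
        linarith [hw x]
    _ ≤ _ := pr_lt_le_pow_div (fun x => walk_nonneg x (fun y => by split_ifs <;> norm_num) 0)
        (by positivity) s
    _ ≤ (θ + 2 ^ s / 2 ^ Fintype.card ι) ^ s / (1 / H) ^ s := by
        gcongr
        exact expect_walk_pow_le hk p hpr hθ1 s 0
    _ = _ := by
        rw [← div_pow, hι, two_mul, pow_add]
        congr 1
        field_simp

end Stages

/-! ### Decay of the total Fourier weight -/

section Decrement

variable {N : ℕ} [NeZero N]

lemma expect_re_sum_sq_le (hodd : Odd N) (w : ZMod N → ℝ) :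
    𝔼 x : ZMod N, (∑ r, w r * (ZMod.stdAddChar (2 * (r * x)) : ℂ).re) ^ 2 ≤ ∑ r, w r ^ 2 := by
  have hN : (0 : ℝ) < N := Nat.cast_pos.mpr (NeZero.pos N)
  have h2 : IsUnit (2 : ZMod N) := by
    have := (ZMod.isUnit_iff_coprime 2 N).mpr (Nat.coprime_two_left.mpr hodd)
    simpa using this
  have hpt : ∀ x : ZMod N, (∑ r, w r * (ZMod.stdAddChar (2 * (r * x)) : ℂ).re) ^ 2 ≤
      N ^ 2 * ‖fourierCoeff (fun z => (w z : ℂ)) (2 * x)‖ ^ 2 := fun x => by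
    have h3 : ∑ r, w r * (ZMod.stdAddChar (2 * (r * x)) : ℂ).re =
        (N * fourierCoeff (fun z => (w z : ℂ)) (2 * x)).re := by
      rw [fourierCoeff, Fintype.expect_eq_sum_div_card, ZMod.card,
        mul_div_cancel₀ _ (Nat.cast_ne_zero.mpr (NeZero.ne N)), Complex.re_sum]
      refine sum_congr rfl fun r _ => ?_
      rw [Complex.re_ofReal_mul, mul_left_comm]
    rw [h3, ← sq_abs, ← mul_pow]
    refine pow_le_pow_left₀ (abs_nonneg _) ((Complex.abs_re_le_norm _).trans_eq ?_) 2
    simp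
  calc _ ≤ 𝔼 x : ZMod N, (N : ℝ) ^ 2 * ‖fourierCoeff (fun z => (w z : ℂ)) (2 * x)‖ ^ 2 :=
        expect_le_expect fun x _ => hpt x
    _ = 𝔼 y : ZMod N, (N : ℝ) ^ 2 * ‖fourierCoeff (fun z => (w z : ℂ)) y‖ ^ 2 :=
        Fintype.expect_equiv h2.unit.mulLeft _ _ fun x => rfl
    _ = ∑ r, w r ^ 2 := by
        rw [← mul_expect, Fintype.expect_eq_sum_div_card, sum_norm_fourierCoeff_sq,
          Fintype.expect_eq_sum_div_card, ZMod.card]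
        simp only [Complex.norm_real, Real.norm_eq_abs, sq_abs]
        field_simp

/-- One random step reduces a large, well spread total weight by a constant factor, with high
probability. -/
lemma pr_weight_step_le (hodd : Odd N) {w : ZMod N → ℝ} (hw : ∀ r, 0 ≤ w r) {σ : ℝ}
    (hσ : ∀ r, w r ≤ σ) {θ κ : ℝ} (hθ : 0 < θ) (hκ : 4 * σ ≤ κ * θ) (hF : θ < ∑ r, w r) :
    pr (fun x : ZMod N => 3 / 4 * ∑ r, w r < ∑ r, w r * cosSq (r * x)) ≤ κ := by
  set F := ∑ r, w r with hF_def
  have hF0 : 0 < F := hθ.trans hF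
  have hsplit : ∀ x : ZMod N, ∑ r, w r * cosSq (r * x) =
      (F + ∑ r, w r * (ZMod.stdAddChar (2 * (r * x)) : ℂ).re) / 2 := fun x => by
    rw [hF_def, ← sum_add_distrib, sum_div]
    refine sum_congr rfl fun r _ => ?_
    rw [cosSq_eq]
    ring
  calc _ ≤ pr (fun x : ZMod N => (F / 2) ^ 2 <
        (∑ r, w r * (ZMod.stdAddChar (2 * (r * x)) : ℂ).re) ^ 2) := by
        refine pr_mono fun x hx => ?_
        rw [hsplit] at hx
        exact pow_lt_pow_left₀ (by linarith) (by positivity) two_ne_zero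
    _ ≤ _ := pr_lt_le_div (fun x => sq_nonneg _) (by positivity)
    _ ≤ (σ * F) / (F / 2) ^ 2 := by
        gcongr
        refine (expect_re_sum_sq_le hodd w).trans ?_
        rw [hF_def, mul_sum]
        exact sum_le_sum fun r _ => by nlinarith [hw r, hσ r]
    _ ≤ κ := by
        have hκ0 : 0 ≤ κ := by
          by_contra h
          have := (hw 0).trans (hσ 0)
          nlinarith
        rw [div_le_iff₀ (by positivity)]
        nlinarith [mul_le_mul_of_nonneg_left hF.le hκ0]

lemma pr_weight_decay_le (hodd : Odd N) {σ θ κ : ℝ} (hθ : 0 < θ) (hκ0 : 0 ≤ κ)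
    (hκ : 4 * σ ≤ κ * θ) {β : ℕ} (hβ : (3 / 4 : ℝ) ^ β ≤ κ) (m : ℕ) :
    ∀ w : ZMod N → ℝ, (∀ r, 0 ≤ w r) → (∀ r, w r ≤ σ) →
      pr (fun x : Fin m → ZMod N => θ < ∑ r, w r * ∏ i, cosSq (r * x i)) ≤
        (2 * κ) ^ m * ((∑ r, w r) / θ) ^ β := by
  induction m with
  | zero =>
    intro w hw hσ
    by_cases hF : θ < ∑ r, w r
    · refine (pr_le_one _).trans ?_
      rw [pow_zero, one_mul]
      exact one_le_pow₀ ((one_le_div hθ).mpr hF.le)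
    · rw [pr_false fun x => by simpa using hF]
      have : 0 ≤ ∑ r, w r := sum_nonneg fun r _ => hw r
      positivity
  | succ m ih =>
    intro w hw hσ
    have hF0 : 0 ≤ ∑ r, w r := sum_nonneg fun r _ => hw r
    have hle : ∀ x : ZMod N, ∑ r, w r * cosSq (r * x) ≤ ∑ r, w r := fun x =>
      sum_le_sum fun r _ => mul_le_of_le_one_right (hw r) (cosSq_le_one _)
    have hnn : ∀ x : ZMod N, 0 ≤ ∑ r, w r * cosSq (r * x) := fun x =>
      sum_nonneg fun r _ => mul_nonneg (hw r) (cosSq_nonneg _)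
    by_cases hF : θ < ∑ r, w r
    · set F := ∑ r, w r with hF_def
      have hstep := pr_weight_step_le hodd hw hσ hθ hκ hF
      let e : (Fin m → ZMod N) × ZMod N ≃ (Fin (m + 1) → ZMod N) :=
        (Equiv.prodComm _ _).trans (Fin.consEquiv fun _ => ZMod N)
      have he : ∀ a b, e (a, b) = Fin.cons b a := fun a b => rfl
      rw [← pr_equiv e, pr_prod]
      calc _ ≤ 𝔼 b : ZMod N, (2 * κ) ^ m * ((∑ r, w r * cosSq (r * b)) / θ) ^ β := by
            refine expect_le_expect fun b _ => ?_
            refine le_trans (pr_mono fun a ha => ?_) (ih (fun r => w r * cosSq (r * b))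
              (fun r => mul_nonneg (hw r) (cosSq_nonneg _))
              fun r => (mul_le_of_le_one_right (hw r) (cosSq_le_one _)).trans (hσ r))
            rw [he] at ha
            simpa [Fin.prod_univ_succ, mul_assoc] using ha
        _ ≤ 𝔼 b : ZMod N, (2 * κ) ^ m * ((F / θ) ^ β *
              ((if 3 / 4 * F < ∑ r, w r * cosSq (r * b) then (1 : ℝ) else 0) + κ)) := by
            refine expect_le_expect fun b _ => ?_
            gcongr
            split_ifs with h
            · calc _ ≤ (F / θ) ^ β := by
                    have := hnn b
                    have := hle b
                    gcongr
                _ ≤ _ := le_mul_of_one_le_right (by positivity) (by linarith)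
            · calc _ ≤ (3 / 4 * F / θ) ^ β := by
                    have := hnn b
                    have := not_lt.mp h
                    gcongr
                _ = (F / θ) ^ β * (3 / 4) ^ β := by rw [← mul_pow]; ring
                _ ≤ _ := by
                    rw [zero_add]
                    gcongr
        _ = (2 * κ) ^ m * ((F / θ) ^ β *
              (pr (fun x : ZMod N => 3 / 4 * F < ∑ r, w r * cosSq (r * x)) + κ)) := by
            rw [← mul_expect, ← mul_expect, expect_add_distrib, Fintype.expect_const, pr]
        _ ≤ (2 * κ) ^ m * ((F / θ) ^ β * (κ + κ)) := by gcongr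
        _ = _ := by ring
    · rw [pr_false fun x => not_lt.mpr ?_]
      · positivity
      · refine le_trans (sum_le_sum fun r _ => mul_le_of_le_one_right (hw r) ?_) (not_lt.mp hF)
        exact prod_le_one (fun _ _ => cosSq_nonneg _) fun _ _ => cosSq_le_one _

end Decrement

/-! ### Vectors with large concentration at zero -/

section Core

variable {k s : ℕ}

lemma pr_last_two_blocks_le (hk : k ≠ 0) {f : ZMod (3 ^ k) → ℝ} (hf : ∀ z, 0 ≤ f z)
    (h1 : 𝔼 z, f z = 1) {H σ θ κ : ℝ} (hH0 : 0 < H) (hH : ∀ z, f z ≤ H)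
    (hσ : ∀ r, r ≠ 0 → weight f r ≤ σ) (hσ0 : 0 ≤ σ) (hθ : 0 < θ) (hθ1 : θ ≤ 1) (hκ0 : 0 ≤ κ)
    (hκ : 4 * σ ≤ κ * θ) {β : ℕ} (hβ : (3 / 4 : ℝ) ^ β ≤ κ) :
    pr (fun p : (Fin (2 * s) → ZMod (3 ^ k)) × (Fin s → ZMod (3 ^ k)) =>
      3 < walk p.1 (walk p.2 f) 0) ≤
      (2 * κ) ^ s * (H / θ) ^ β + (H * (θ + 1 / 2 ^ s)) ^ s := by
  have hodd : Odd (3 ^ k) := Odd.pow (by decide)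
  set w : ZMod (3 ^ k) → ℝ := fun r => if r = 0 then 0 else weight f r with hw_def
  have hw : ∀ r, 0 ≤ w r := fun r => by
    simp only [hw_def]; split_ifs; exacts [le_rfl, weight_nonneg f r]
  have hwσ : ∀ r, w r ≤ σ := fun r => by
    simp only [hw_def]; split_ifs with h; exacts [hσ0, hσ r h]
  have hwH : ∑ r, w r ≤ H := by
    calc ∑ r, w r ≤ ∑ r, weight f r := by
          refine sum_le_sum fun r _ => ?_
          simp only [hw_def]; split_ifs; exacts [weight_nonneg f r, le_rfl]
      _ = 𝔼 z, f z ^ 2 := sum_weight f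
      _ ≤ 𝔼 z, H * f z := expect_le_expect fun z _ => by nlinarith [hf z, hH z]
      _ = H := by rw [← mul_expect, h1, mul_one]
  have hw0 : 0 ≤ ∑ r, w r := sum_nonneg fun r _ => hw r
  refine pr_prod_le (q := fun y => θ < ∑ r, w r * ∏ i, cosSq (r * y i)) (by positivity) ?_ ?_
  · refine (pr_weight_decay_le hodd hθ hκ0 hκ hβ s w hw hwσ).trans ?_
    gcongr
  · intro y hy
    refine pr_walk_zero_le hk hH0 (walk_le y hH) hθ1 ?_ (by simp)
    rw [← sum_weight_erase_zero ((expect_walk y f).trans h1)]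
    refine le_trans (le_of_eq ?_) (not_lt.mp hy)
    rw [← add_sum_erase _ _ (mem_univ (0 : ZMod (3 ^ k)))]
    simp only [hw_def, if_true, zero_mul, zero_add]
    refine sum_congr rfl fun r hr => ?_
    rw [weight_walk, if_neg (ne_of_mem_erase hr)]

lemma pr_last_three_blocks_le (hk : k ≠ 0) {f : ZMod (3 ^ k) → ℝ} (hf : ∀ z, 0 ≤ f z)
    (h1 : 𝔼 z, f z = 1) {H σ θ κ κ' : ℝ} (hH0 : 0 < H) (hH : ∀ z, f z ≤ H)
    (hσ0 : 0 < σ) (hθ : 0 < θ) (hθ1 : θ ≤ 1) (hκ0 : 0 ≤ κ)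
    (hκ : 4 * σ ≤ κ * θ) {β : ℕ} (hβ : (3 / 4 : ℝ) ^ β ≤ κ) (hκ' : 0 ≤ κ') {b : ℕ}
    (hb : ∀ r : ZMod (3 ^ k), r ≠ 0 →
      𝔼 x : ZMod (3 ^ k), (if IsUnit x then cosSq (r * x) ^ b else 0) ≤ κ') :
    pr (fun p : ((Fin (2 * s) → ZMod (3 ^ k)) × (Fin s → ZMod (3 ^ k))) ×
        (Fin s → ZMod (3 ^ k)) =>
      (∀ i, IsUnit (p.2 i)) ∧ 3 < walk p.1.1 (walk p.1.2 (walk p.2 f)) 0) ≤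
      H / σ * (κ' ^ s / σ ^ b) +
        ((2 * κ) ^ s * (H / θ) ^ β + (H * (θ + 1 / 2 ^ s)) ^ s) := by
  have hnn : 0 ≤ (2 * κ) ^ s * (H / θ) ^ β + (H * (θ + 1 / 2 ^ s)) ^ s := by positivity
  refine pr_prod_le (q := fun x : Fin s → ZMod (3 ^ k) =>
    (∀ i, IsUnit (x i)) ∧ ∃ r, r ≠ 0 ∧ σ < weight (walk x f) r) hnn ?_ ?_
  · simpa using pr_exists_weight_walk_le (ι := Fin s) hκ' hb hf h1 hH hσ0
  · intro x hx
    by_cases hu : ∀ i, IsUnit (x i)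
    · have hsmall : ∀ r, r ≠ 0 → weight (walk x f) r ≤ σ := fun r hr =>
        not_lt.mp fun h => hx ⟨hu, r, hr, h⟩
      exact (pr_mono fun p hp => hp.2).trans
        (pr_last_two_blocks_le hk (walk_nonneg x hf) ((expect_walk x f).trans h1) hH0
          (walk_le x hH) hsmall hσ0.le hθ hθ1 hκ0 hκ hβ)
    · rw [pr_false fun p hp => hu hp.1]
      exact hnn

lemma exists_block_equiv {n : ℕ} (hs : 4 * s ≤ n) (J : Finset (Fin n)) (hJ : #J = s) :
    ∃ e : ((Fin (2 * s) ⊕ Fin s) ⊕ Fin s) ⊕ Fin (n - 4 * s) ≃ Fin n,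
      ∀ j, e (Sum.inl (Sum.inr j)) ∈ J := by
  classical
  let e₀ : ((Fin (2 * s) ⊕ Fin s) ⊕ Fin s) ⊕ Fin (n - 4 * s) ≃ Fin n :=
    Fintype.equivOfCardEq (by simp; omega)
  let I : Finset (Fin n) := univ.map
    ⟨fun j => e₀ (Sum.inl (Sum.inr j)), fun a b h => by simpa using h⟩
  let e₁ : {i // i ∈ I} ≃ {i // i ∈ J} := Fintype.equivOfCardEq (by
    rw [Fintype.card_coe, Fintype.card_coe, hJ, card_map, card_univ, Fintype.card_fin])
  refine ⟨e₀.trans e₁.extendSubtype, fun j => e₁.extendSubtype_mem _ ?_⟩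
  exact mem_map.mpr ⟨j, mem_univ j, rfl⟩

lemma pr_units_and_walk_le (hk : k ≠ 0) {n : ℕ} (hs : 4 * s ≤ n)
    (hq : 3 ^ k * 2 ^ (5 * s) ≤ 2 ^ n) {H σ θ κ κ' : ℝ} (hH0 : 0 < H)
    (hσ0 : 0 < σ) (hθ : 0 < θ) (hθ1 : θ ≤ 1) (hκ0 : 0 ≤ κ)
    (hκ : 4 * σ ≤ κ * θ) {β : ℕ} (hβ : (3 / 4 : ℝ) ^ β ≤ κ) (hκ' : 0 ≤ κ') {b : ℕ}
    (hb : ∀ r : ZMod (3 ^ k), r ≠ 0 →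
      𝔼 x : ZMod (3 ^ k), (if IsUnit x then cosSq (r * x) ^ b else 0) ≤ κ')
    (J : Finset (Fin n)) (hJ : #J = s) :
    pr (fun x : Fin n → ZMod (3 ^ k) =>
      (∀ i ∈ J, IsUnit (x i)) ∧ 3 < walk x (pointDensity (3 ^ k)) 0) ≤
      3 ^ k * (2 / H) ^ s + (H / σ * (κ' ^ s / σ ^ b) +
        ((2 * κ) ^ s * (H / θ) ^ β + (H * (θ + 1 / 2 ^ s)) ^ s)) := by
  obtain ⟨e, he⟩ := exists_block_equiv hs J hJ
  let E : (((Fin (2 * s) → ZMod (3 ^ k)) × (Fin s → ZMod (3 ^ k))) × (Fin s → ZMod (3 ^ k))) ×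
      (Fin (n - 4 * s) → ZMod (3 ^ k)) ≃ (Fin n → ZMod (3 ^ k)) :=
    { toFun := fun p =>
        Sum.elim (Sum.elim (Sum.elim p.1.1.1 p.1.1.2) p.1.2) p.2 ∘ e.symm
      invFun := fun x => (((fun i => x (e (.inl (.inl (.inl i)))),
        fun i => x (e (.inl (.inl (.inr i))))), fun i => x (e (.inl (.inr i)))),
        fun i => x (e (.inr i)))
      left_inv := fun p => by simp
      right_inv := fun x => by
        ext i
        obtain ⟨t, rfl⟩ := e.surjective i
        rcases t with ((t | t) | t) | t <;> simp }
  have hE : ∀ p, walk (E p) (pointDensity (3 ^ k)) 0 =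
      walk p.1.1.1 (walk p.1.1.2 (walk p.1.2 (walk p.2 (pointDensity (3 ^ k))))) 0 := fun p => by
    rw [show E p = Sum.elim (Sum.elim (Sum.elim p.1.1.1 p.1.1.2) p.1.2) p.2 ∘ e.symm from rfl,
      walk_comp_equiv, walk_sumElim, walk_sumElim, walk_sumElim]
  have hEu : ∀ p j, E p (e (Sum.inl (Sum.inr j))) = p.1.2 j := fun p j => by simp [E]
  rw [← pr_equiv E]
  have hnn : 0 ≤ H / σ * (κ' ^ s / σ ^ b) +
      ((2 * κ) ^ s * (H / θ) ^ β + (H * (θ + 1 / 2 ^ s)) ^ s) := by positivity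
  refine pr_prod_le (q := fun x : Fin (n - 4 * s) → ZMod (3 ^ k) =>
    ∃ z, H < walk x (pointDensity (3 ^ k)) z) hnn ?_ ?_
  · exact pr_exists_walk_pointDensity_le hk (by rw [Fintype.card_fin]; omega) hq hH0
  · intro x hx
    refine le_trans (pr_mono fun p hp => ?_)
      (pr_last_three_blocks_le (f := walk x (pointDensity (3 ^ k))) hk
        (walk_nonneg x pointDensity_nonneg) ((expect_walk x _).trans expect_pointDensity) hH0
        (fun z => not_lt.mp fun h => hx ⟨z, h⟩) hσ0 hθ hθ1 hκ0 hκ hβ hκ' hb)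
    refine ⟨fun j => ?_, ?_⟩
    · rw [← hEu (p, x) j]
      exact hp.1 _ (he j)
    · rw [← hE (p, x)]
      exact hp.2

/-- Vectors with many unit coordinates whose signed sums concentrate at zero are
super-exponentially rare. -/
theorem exists_pr_concentrated_le (C : ℕ) {A : ℝ} (hA : 1 ≤ A) :
    ∃ n₀ : ℕ, ∀ n, n₀ ≤ n → ∀ s k : ℕ, k ≠ 0 → n ≤ C * s → 4 * s ≤ n →
      3 ^ k * 2 ^ (5 * s) ≤ 2 ^ n →
      A ^ n * pr (fun x : Fin n → ZMod (3 ^ k) =>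
        s ≤ #{i | IsUnit (x i)} ∧ 3 < walk x (pointDensity (3 ^ k)) 0) ≤ 1 := by
  set B : ℝ := 8 * A with hB
  have hB1 : 1 ≤ B := by linarith
  set L : ℝ := B ^ C with hL
  have hL1 : 1 ≤ L := one_le_pow₀ hB1
  set H : ℝ := 2 * (2 * B) ^ C with hH
  have hH1 : 2 ≤ H := by
    have : 1 ≤ (2 * B) ^ C := one_le_pow₀ (by linarith)
    linarith
  set θ : ℝ := 1 / (2 * H * L) with hθ
  set κ : ℝ := 1 / (4 * L) with hκ
  set κ' : ℝ := 1 / (2 * L) with hκ'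
  set σ : ℝ := κ * θ / 4 with hσ
  have hL0 : 0 < L := by linarith
  have hH0 : 0 < H := by linarith
  have hκ0 : 0 < κ := by positivity
  have hκ0' : 0 < κ' := by positivity
  have hθ0 : 0 < θ := by positivity
  have hθ1 : θ ≤ 1 := by
    rw [hθ, div_le_one (by positivity)]
    nlinarith
  have hσ0 : 0 < σ := by positivity
  obtain ⟨β, hβ⟩ := exists_pow_lt_of_lt_one hκ0 (show (3 / 4 : ℝ) < 1 by norm_num)
  obtain ⟨b, hb⟩ := exists_expect_cosSq_pow_le hκ0'
  obtain ⟨s₀, hs₀⟩ := pow_unbounded_of_one_lt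
    (max (1 / θ) (max ((H / θ) ^ β) (H / σ / σ ^ b))) (show (1 : ℝ) < 2 by norm_num)
  refine ⟨C * s₀ + 1, fun n hn s k hk hns hs hq => ?_⟩
  have hs0 : s₀ ≤ s := by
    by_contra h
    have := Nat.mul_le_mul_left C (not_le.mp h).le
    omega
  have h2s : (2 : ℝ) ^ s₀ ≤ 2 ^ s := pow_le_pow_right₀ (by norm_num) hs0
  have hbig := hs₀.le.trans h2s
  have hbig1 : 1 / θ ≤ 2 ^ s := (le_max_left _ _).trans hbig
  have hbig2 : (H / θ) ^ β ≤ 2 ^ s := ((le_max_left _ _).trans (le_max_right _ _)).trans hbig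
  have hbig3 : H / σ / σ ^ b ≤ 2 ^ s := ((le_max_right _ _).trans (le_max_right _ _)).trans hbig
  have hLs : (1 / L) ^ s ≤ (1 / B) ^ n := by
    rw [one_div_pow, one_div_pow]
    gcongr
    rw [hL, ← pow_mul]
    exact pow_le_pow_right₀ hB1 hns
  have hodd : Odd (3 ^ k) := Odd.pow (by decide)
  have t1 : (3 : ℝ) ^ k * (2 / H) ^ s ≤ (1 / B) ^ n := by
    have h3 : (3 : ℝ) ^ k ≤ 2 ^ n := by
      have : 3 ^ k ≤ 2 ^ n := le_trans (Nat.le_mul_of_pos_right _ (by positivity)) hq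
      exact_mod_cast this
    calc (3 : ℝ) ^ k * (2 / H) ^ s = 3 ^ k * (1 / (2 * B) ^ (C * s)) := by
          rw [hH, pow_mul, ← one_div_pow]
          congr 2
          field_simp
      _ ≤ 2 ^ n * (1 / (2 * B) ^ n) := by
          gcongr
          linarith
      _ = (1 / B) ^ n := by
          rw [mul_pow, one_div_pow]
          field_simp
  have t2 : H / σ * (κ' ^ s / σ ^ b) ≤ (1 / B) ^ n := by
    calc H / σ * (κ' ^ s / σ ^ b) = (H / σ / σ ^ b) * κ' ^ s := by ring
      _ ≤ 2 ^ s * κ' ^ s := by gcongr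
      _ = (1 / L) ^ s := by
          rw [← mul_pow, hκ']
          congr 1
          field_simp
      _ ≤ _ := hLs
  have t3 : (2 * κ) ^ s * (H / θ) ^ β ≤ (1 / B) ^ n := by
    calc (2 * κ) ^ s * (H / θ) ^ β ≤ (2 * κ) ^ s * 2 ^ s := by gcongr
      _ = (1 / L) ^ s := by
          rw [← mul_pow, hκ]
          congr 1
          field_simp
          norm_num
      _ ≤ _ := hLs
  have t4 : (H * (θ + 1 / 2 ^ s)) ^ s ≤ (1 / B) ^ n := by
    have h5 : (1 : ℝ) / 2 ^ s ≤ θ := by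
      rw [div_le_iff₀ (by positivity)]
      rw [div_le_iff₀ hθ0] at hbig1
      linarith
    calc (H * (θ + 1 / 2 ^ s)) ^ s ≤ (H * (θ + θ)) ^ s := by gcongr
      _ = (1 / L) ^ s := by
          congr 1
          rw [hθ]
          field_simp
          norm_num
      _ ≤ _ := hLs
  have hJ : ∀ J ∈ powersetCard s (univ : Finset (Fin n)), pr (fun x : Fin n → ZMod (3 ^ k) =>
      (∀ i ∈ J, IsUnit (x i)) ∧ 3 < walk x (pointDensity (3 ^ k)) 0) ≤ 4 * (1 / B) ^ n :=
    fun J hJ => by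
      refine (pr_units_and_walk_le hk hs hq hH0 hσ0 hθ0 hθ1 hκ0.le (by rw [hσ]; linarith) hβ.le
        hκ0'.le (fun r hr => hb (3 ^ k) hodd r hr) J (mem_powersetCard.mp hJ).2).trans ?_
      linarith
  have hcard : (#(powersetCard s (univ : Finset (Fin n))) : ℝ) ≤ 2 ^ n := by
    rw [card_powersetCard, card_univ, Fintype.card_fin]
    exact_mod_cast Nat.choose_le_two_pow n s
  have hfour : (4 : ℝ) ≤ 4 ^ n := by
    simpa using pow_le_pow_right₀ (show (1 : ℝ) ≤ 4 by norm_num) (show 1 ≤ n by omega)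
  calc _ ≤ A ^ n * pr (fun x : Fin n → ZMod (3 ^ k) =>
        ∃ J ∈ powersetCard s (univ : Finset (Fin n)),
          (∀ i ∈ J, IsUnit (x i)) ∧ 3 < walk x (pointDensity (3 ^ k)) 0) := by
        gcongr
        refine pr_mono fun x ⟨hx1, hx2⟩ => ?_
        obtain ⟨J, hJx, hJs⟩ := exists_subset_card_eq hx1
        exact ⟨J, mem_powersetCard.mpr ⟨subset_univ J, hJs⟩,
          fun i hi => (mem_filter.mp (hJx hi)).2, hx2⟩
    _ ≤ A ^ n * ∑ J ∈ powersetCard s (univ : Finset (Fin n)), 4 * (1 / B) ^ n := by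
        gcongr
        exact (pr_exists_mem_le _ _).trans (sum_le_sum hJ)
    _ ≤ A ^ n * (2 ^ n * (4 ^ n * (1 / B) ^ n)) := by
        rw [sum_const, nsmul_eq_mul]
        gcongr
    _ = 1 := by
        rw [← mul_pow, ← mul_pow, ← mul_pow, hB]
        have : A ≠ 0 := by positivity
        field_simp
        norm_num

end Core

/-! ### Kernel vectors of random sign matrices -/

section Kernel

lemma walk_pointDensity_zero {ι : Type*} [Fintype ι] [DecidableEq ι] {k : ℕ}
    (x : ι → ZMod (3 ^ k)) :
    walk x (pointDensity (3 ^ k)) 0 = 3 ^ k * pr (fun ε : ι → Bool => signSum ε x = 0) := by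
  rw [walk, pr, mul_expect]
  refine expect_congr rfl fun ε _ => ?_
  by_cases h : signSum ε x = 0 <;> simp [pointDensity, h]

lemma signSum_intCast {ι R : Type*} [Fintype ι] [CommRing R] (ε : ι → Bool) (v : ι → ℤ) :
    signSum ε (fun i => (v i : R)) = ((signSum ε v : ℤ) : R) := by
  simp [signSum]

lemma signSum_zmod_eq_zero_iff {ι : Type*} [Fintype ι] (N : ℕ) (ε : ι → Bool) (v : ι → ℤ) :
    signSum ε (fun i => (v i : ZMod N)) = 0 ↔ (N : ℤ) ∣ signSum ε v := by
  rw [signSum_intCast, ZMod.intCast_zmod_eq_zero_iff_dvd]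

lemma exists_kernel_vector {m : ℕ} (F : Fin m → Fin (m + 1) → Bool) :
    ∃ v : Fin (m + 1) → ℤ, (∀ t, signSum (F t) v = 0) ∧ ∃ j, ¬ 3 ∣ v j := by
  let M : Matrix (Fin (m + 1)) (Fin (m + 1)) ℤ :=
    Matrix.of (Fin.cons 0 fun t j => sgn (F t j))
  obtain ⟨u, hu0, hu⟩ := Matrix.exists_mulVec_eq_zero_iff.mpr
    (Matrix.det_eq_zero_of_row_eq_zero (A := M) 0 fun j => rfl)
  have huF : ∀ t, signSum (F t) u = 0 := fun t => by
    have := congrFun hu t.succ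
    simpa [M, Matrix.mulVec, dotProduct, signSum] using this
  obtain ⟨g, hg, hg1⟩ := Finset.extract_gcd u (univ_nonempty (α := Fin (m + 1)))
  have hgcd : univ.gcd u ≠ 0 := fun h => hu0 (funext fun j => by
    rw [hg j (mem_univ j), h, zero_mul, Pi.zero_apply])
  refine ⟨g, fun t => ?_, ?_⟩
  · have h1 : univ.gcd u * signSum (F t) g = 0 := by
      rw [← huF t, signSum, signSum, mul_sum]
      refine sum_congr rfl fun j _ => ?_
      rw [hg j (mem_univ j)]
      ring
    exact (mul_eq_zero.mp h1).resolve_left hgcd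
  · by_contra! h
    have : (3 : ℤ) ∣ univ.gcd g := dvd_gcd fun j _ => h j
    rw [hg1] at this
    norm_num at this

/-- A singular sign matrix has a row orthogonal to every kernel vector of the other rows. -/
lemma exists_signSum_eq_zero_of_det_eq_zero {m : ℕ} (E : Fin (m + 1) → Fin (m + 1) → Bool)
    (hE : (Matrix.of fun i j => sgn (E i j)).det = 0) :
    ∃ i, ∀ v : Fin (m + 1) → ℤ, (∀ t, signSum (E (i.succAbove t)) v = 0) →
      signSum (E i) v = 0 := by
  obtain ⟨u, hu0, hu⟩ := Matrix.exists_vecMul_eq_zero_iff.mpr hE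
  obtain ⟨i, hi⟩ := Function.ne_iff.mp hu0
  refine ⟨i, fun v hv => ?_⟩
  have h1 : ∑ l, u l * signSum (E l) v = 0 := by
    have h2 : u ⬝ᵥ ((Matrix.of fun i j => sgn (E i j)).mulVec v) = 0 := by
      rw [Matrix.dotProduct_mulVec, hu, zero_dotProduct]
    simpa [dotProduct, Matrix.mulVec, signSum] using h2
  rw [Fin.sum_univ_succAbove _ i] at h1
  simp only [hv, mul_zero, sum_const_zero, add_zero] at h1
  exact (mul_eq_zero.mp h1).resolve_left hi

lemma pr_signSum_eq_zero_le_half {ι : Type*} [Fintype ι] [DecidableEq ι] {x : ι → ZMod 3}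
    (hx : x ≠ 0) : pr (fun ε : ι → Bool => signSum ε x = 0) ≤ 1 / 2 := by
  let W : Submodule (ZMod 3) (ι → ZMod 3) := LinearMap.ker (Fintype.linearCombination (ZMod 3) x)
  have hmem : ∀ ε : ι → Bool, signVec ε ∈ W ↔ signSum ε x = 0 := fun ε => by
    simp [W, LinearMap.mem_ker, Fintype.linearCombination_apply, signVec, signSum]
  have hW : W ≠ ⊤ := fun h => hx (funext fun i => by
    have : Pi.single i 1 ∈ W := h ▸ Submodule.mem_top
    simpa [W, LinearMap.mem_ker, Fintype.linearCombination_apply_single] using this)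
  have hfin : Module.finrank (ZMod 3) W + 1 ≤ Fintype.card ι := by
    simpa using Submodule.finrank_lt hW
  have h := pr_signVec_mem_le W
  simp only [hmem] at h
  refine h.trans ?_
  rw [div_le_div_iff₀ (by positivity) two_pos, one_mul, ← pow_succ]
  exact pow_le_pow_right₀ (by norm_num) hfin

lemma pr_forall_signSum_eq_zero {n m N : ℕ} (x : Fin n → ZMod N) :
    pr (fun F : Fin m → Fin n → Bool => ∀ t, signSum (F t) x = 0) =
      pr (fun ε : Fin n → Bool => signSum ε x = 0) ^ m := by
  rw [pr_pi (fun (_ : Fin m) (ε : Fin n → Bool) => signSum ε x = 0)]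
  simp

lemma sum_pow_support (n : ℕ) (c : ℝ) :
    ∑ x : Fin n → ZMod 3, c ^ #{i | x i ≠ 0} = (1 + 2 * c) ^ n := by
  have h : ∀ x : Fin n → ZMod 3, c ^ #{i | x i ≠ 0} = ∏ i, (if x i ≠ 0 then c else 1) :=
    fun x => by rw [prod_ite, prod_const, prod_const_one, mul_one]
  have h3 : ∑ a : ZMod 3, (if a ≠ 0 then c else 1) = 1 + 2 * c := by
    change ∑ a : Fin 3, (if a ≠ 0 then c else 1) = 1 + 2 * c
    simp [Fin.sum_univ_three]
    ring
  simp only [h]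
  rw [← Fintype.piFinset_univ, ← prod_univ_sum (fun _ => univ)
    fun (_ : Fin n) (a : ZMod 3) => if a ≠ 0 then c else 1]
  simp only [h3, prod_const, card_univ, Fintype.card_fin]

lemma card_sparse_le (n s : ℕ) {c : ℝ} (hc : 0 < c) (hc1 : c ≤ 1) :
    (#{x : Fin n → ZMod 3 | #{i | x i ≠ 0} < s} : ℝ) ≤ (1 + 2 * c) ^ n / c ^ s := by
  rw [le_div_iff₀ (by positivity), ← sum_pow_support, ← nsmul_eq_mul, ← sum_const]
  refine le_trans (sum_le_sum fun x hx => ?_) (sum_le_univ_sum_of_nonneg fun x => by positivity)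
  exact pow_le_pow_of_le_one hc.le hc1 (mem_filter.mp hx).2.le

lemma pr_sparse_kernel_le (n m s : ℕ) {c : ℝ} (hc : 0 < c) (hc1 : c ≤ 1) :
    pr (fun F : Fin m → Fin n → Bool => ∃ x : Fin n → ZMod 3,
      x ≠ 0 ∧ #{i | x i ≠ 0} < s ∧ ∀ t, signSum (F t) x = 0) ≤
      (1 + 2 * c) ^ n / c ^ s * (1 / 2) ^ m := by
  classical
  let S : Finset (Fin n → ZMod 3) := {x | x ≠ 0 ∧ #{i | x i ≠ 0} < s}
  have hS : (#S : ℝ) ≤ (1 + 2 * c) ^ n / c ^ s := by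
    refine le_trans ?_ (card_sparse_le n s hc hc1)
    exact_mod_cast card_le_card fun x hx => by
      simp only [S, mem_filter] at hx ⊢
      exact ⟨hx.1, hx.2.2⟩
  calc _ ≤ pr (fun F : Fin m → Fin n → Bool => ∃ x ∈ S, ∀ t, signSum (F t) x = 0) :=
        pr_mono fun F ⟨x, hx0, hxs, hxF⟩ => ⟨x, by simp only [S, mem_filter]; exact
          ⟨mem_univ x, hx0, hxs⟩, hxF⟩
    _ ≤ ∑ x ∈ S, (1 / 2 : ℝ) ^ m := by
        refine (pr_exists_mem_le _ _).trans (sum_le_sum fun x hx => ?_)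
        rw [pr_forall_signSum_eq_zero]
        exact pow_le_pow_left₀ (pr_nonneg _) (pr_signSum_eq_zero_le_half (mem_filter.mp hx).2.1) m
    _ = #S * (1 / 2 : ℝ) ^ m := by rw [sum_const, nsmul_eq_mul]
    _ ≤ _ := by gcongr

lemma pr_structured_kernel_le {n m k : ℕ} (hn : n = m + 1) (p : (Fin n → ZMod (3 ^ k)) → Prop)
    (hp : 36 ^ n * pr p ≤ 1) (hk : 3 ^ k ≤ 2 ^ n) :
    pr (fun F : Fin m → Fin n → Bool => ∃ x : Fin n → ZMod (3 ^ k),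
      p x ∧ walk x (pointDensity (3 ^ k)) 0 ≤ 9 ∧ ∀ t, signSum (F t) x = 0) ≤ (1 / 2) ^ n := by
  classical
  have hq : (0 : ℝ) < 3 ^ k := by positivity
  let S : Finset (Fin n → ZMod (3 ^ k)) := {x | p x ∧ walk x (pointDensity (3 ^ k)) 0 ≤ 9}
  have hS : (#S : ℝ) ≤ (3 ^ k) ^ n * pr p := by
    have h1 : (#{x | p x} : ℝ) = (3 ^ k) ^ n * pr p := by
      rw [pr_eq_card p, Fintype.card_fun, ZMod.card, Fintype.card_fin]
      push_cast
      field_simp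
    rw [← h1]
    exact_mod_cast card_le_card fun x hx => by
      simp only [S, mem_filter] at hx ⊢
      exact ⟨hx.1, hx.2.1⟩
  calc _ ≤ pr (fun F : Fin m → Fin n → Bool => ∃ x ∈ S, ∀ t, signSum (F t) x = 0) :=
        pr_mono fun F ⟨x, hx0, hxs, hxF⟩ => ⟨x, by simp only [S, mem_filter]; exact
          ⟨mem_univ x, hx0, hxs⟩, hxF⟩
    _ ≤ ∑ x ∈ S, (9 / 3 ^ k : ℝ) ^ m := by
        refine (pr_exists_mem_le _ _).trans (sum_le_sum fun x hx => ?_)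
        rw [pr_forall_signSum_eq_zero]
        refine pow_le_pow_left₀ (pr_nonneg _) ?_ m
        have := (mem_filter.mp hx).2.2
        rw [walk_pointDensity_zero] at this
        rw [le_div_iff₀ hq]
        linarith
    _ = #S * (9 / 3 ^ k : ℝ) ^ m := by rw [sum_const, nsmul_eq_mul]
    _ ≤ (3 ^ k) ^ n * pr p * (9 / 3 ^ k : ℝ) ^ m := by gcongr
    _ = 3 ^ k * 9 ^ m * pr p := by
        have h2 : ((3 : ℝ) ^ k) ^ n = (3 ^ k) ^ m * 3 ^ k := by rw [hn, pow_succ]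
        rw [h2, div_pow]
        field_simp
    _ ≤ 2 ^ n * 9 ^ n * pr p := by
        have h2 : (3 : ℝ) ^ k ≤ 2 ^ n := by exact_mod_cast hk
        have := pr_nonneg p
        gcongr
        · norm_num
        · omega
    _ = (1 / 2) ^ n * (36 ^ n * pr p) := by
        rw [← mul_assoc, ← mul_pow, ← mul_pow]
        norm_num
    _ ≤ (1 / 2) ^ n := mul_le_of_le_one_right (by positivity) hp

end Kernel

/-! ### The singularity probability -/

section Singularity

variable {ι : Type*} [Fintype ι] [DecidableEq ι]

/-- The probability that `3 ^ k` divides a random signed sum of `v`, relative to `3 ^ (-k)`. -/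
noncomputable def divDensity (v : ι → ℤ) (k : ℕ) : ℝ :=
  3 ^ k * pr (fun ε : ι → Bool => (3 : ℤ) ^ k ∣ signSum ε v)

lemma walk_intCast_pointDensity (v : ι → ℤ) (k : ℕ) :
    walk (fun i => (v i : ZMod (3 ^ k))) (pointDensity (3 ^ k)) 0 = divDensity v k := by
  rw [walk_pointDensity_zero, divDensity]
  simp only [signSum_zmod_eq_zero_iff]
  push_cast
  rfl

lemma divDensity_zero_le (v : ι → ℤ) : divDensity v 0 ≤ 1 := by
  rw [divDensity, pow_zero, one_mul]
  exact pr_le_one _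

lemma divDensity_succ_le (v : ι → ℤ) (k : ℕ) : divDensity v (k + 1) ≤ 3 * divDensity v k := by
  rw [divDensity, divDensity, pow_succ', mul_assoc]
  gcongr
  exact pr_mono fun ε h => (pow_dvd_pow 3 k.le_succ).trans h

lemma exists_divDensity_mem_Ioc (v : ι → ℤ) {K : ℕ} (hK : 3 < divDensity v K) :
    ∃ k ∈ Icc 1 K, 3 < divDensity v k ∧ divDensity v k ≤ 9 := by
  classical
  have hex : ∃ k, 3 < divDensity v k := ⟨K, hK⟩
  have hspec := Nat.find_spec hex
  have hle : Nat.find hex ≤ K := Nat.find_min' hex hK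
  rcases hk : Nat.find hex with _ | k
  · rw [hk] at hspec
    linarith [divDensity_zero_le v]
  · have hmin : ¬ 3 < divDensity v k := Nat.find_min hex (by omega)
    rw [hk] at hspec hle
    refine ⟨k + 1, mem_Icc.mpr ⟨by omega, hle⟩, hspec, ?_⟩
    linarith [divDensity_succ_le v k]

/-- Outside a small exceptional event, a kernel vector of `m` random sign vectors of length
`m + 1` has no excess concentration modulo `3 ^ K`. -/
lemma pr_concentrated_kernel_le {m K s : ℕ} {c : ℝ} (hc : 0 < c) (hc1 : c ≤ 1)
    (hK : 3 ^ K ≤ 2 ^ (m + 1))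
    (h : ∀ k ∈ Icc 1 K, 36 ^ (m + 1) * pr (fun x : Fin (m + 1) → ZMod (3 ^ k) =>
      s ≤ #{i | IsUnit (x i)} ∧ 3 < walk x (pointDensity (3 ^ k)) 0) ≤ 1) :
    pr (fun F : Fin m → Fin (m + 1) → Bool => ∃ v : Fin (m + 1) → ℤ,
      (∀ t, signSum (F t) v = 0) ∧ (∃ j, ¬ 3 ∣ v j) ∧ 3 < divDensity v K) ≤
      (1 + 2 * c) ^ (m + 1) / c ^ s * (1 / 2) ^ m + K * (1 / 2) ^ (m + 1) := by
  calc _ ≤ pr (fun F : Fin m → Fin (m + 1) → Bool =>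
        (∃ x : Fin (m + 1) → ZMod 3,
          x ≠ 0 ∧ #{i | x i ≠ 0} < s ∧ ∀ t, signSum (F t) x = 0) ∨
        ∃ k ∈ Icc 1 K, ∃ x : Fin (m + 1) → ZMod (3 ^ k),
          (s ≤ #{i | IsUnit (x i)} ∧ 3 < walk x (pointDensity (3 ^ k)) 0) ∧
          walk x (pointDensity (3 ^ k)) 0 ≤ 9 ∧ ∀ t, signSum (F t) x = 0) := by
        refine pr_mono fun F ⟨v, hv, ⟨j, hj⟩, hvK⟩ => ?_
        rcases lt_or_ge (#{i | (v i : ZMod 3) ≠ 0}) s with hs | hs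
        · refine Or.inl ⟨fun i => v i, fun h0 => hj ?_, hs, fun t => ?_⟩
          · exact_mod_cast (ZMod.intCast_zmod_eq_zero_iff_dvd (v j) 3).mp (congrFun h0 j)
          · rw [signSum_intCast, hv t, Int.cast_zero]
        · obtain ⟨k, hk, hk3, hk9⟩ := exists_divDensity_mem_Ioc v hvK
          have hk0 : k ≠ 0 := by have := (mem_Icc.mp hk).1; omega
          refine Or.inr ⟨k, hk, fun i => v i, ⟨?_, ?_⟩, ?_, fun t => ?_⟩
          · simpa only [isUnit_intCast_zmod_pow hk0] using hs
          · rwa [walk_intCast_pointDensity]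
          · rwa [walk_intCast_pointDensity]
          · rw [signSum_intCast, hv t, Int.cast_zero]
    _ ≤ _ := by
        refine (pr_or_le _ _).trans (add_le_add (pr_sparse_kernel_le _ _ _ hc hc1) ?_)
        refine (pr_exists_mem_le _ _).trans ?_
        calc _ ≤ ∑ k ∈ Icc 1 K, (1 / 2 : ℝ) ^ (m + 1) := sum_le_sum fun k hk =>
              pr_structured_kernel_le rfl _ (h k hk) ((Nat.pow_le_pow_right (by norm_num)
                (mem_Icc.mp hk).2).trans hK)
          _ = _ := by simp

lemma pr_det_eq_zero_le {m K s : ℕ} {c : ℝ} (hc : 0 < c) (hc1 : c ≤ 1)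
    (hK : 3 ^ K ≤ 2 ^ (m + 1))
    (h : ∀ k ∈ Icc 1 K, 36 ^ (m + 1) * pr (fun x : Fin (m + 1) → ZMod (3 ^ k) =>
      s ≤ #{i | IsUnit (x i)} ∧ 3 < walk x (pointDensity (3 ^ k)) 0) ≤ 1) :
    pr (fun E : Fin (m + 1) → Fin (m + 1) → Bool => (Matrix.of fun i j => sgn (E i j)).det = 0) ≤
      (m + 1) * ((1 + 2 * c) ^ (m + 1) / c ^ s * (1 / 2) ^ m + K * (1 / 2) ^ (m + 1) +
        3 / 3 ^ K) := by
  choose vec hvec hvec3 using fun F : Fin m → Fin (m + 1) → Bool => exists_kernel_vector F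
  calc _ ≤ pr (fun E : Fin (m + 1) → Fin (m + 1) → Bool =>
        ∃ i ∈ univ, signSum (E i) (vec fun t => E (i.succAbove t)) = 0) :=
        pr_mono fun E hE => by
          obtain ⟨i, hi⟩ := exists_signSum_eq_zero_of_det_eq_zero E hE
          exact ⟨i, mem_univ i, hi _ (hvec _)⟩
    _ ≤ ∑ _i : Fin (m + 1), ((1 + 2 * c) ^ (m + 1) / c ^ s * (1 / 2) ^ m +
          K * (1 / 2) ^ (m + 1) + 3 / 3 ^ K : ℝ) := by
        refine (pr_exists_mem_le _ _).trans (sum_le_sum fun i _ => ?_)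
        rw [← pr_equiv (Fin.insertNthEquiv (fun _ => Fin (m + 1) → Bool) i)]
        refine pr_prod_le (by positivity) (pr_concentrated_kernel_le hc hc1 hK h) fun F hF => ?_
        simp only [Fin.insertNthEquiv_apply, Fin.insertNth_apply_same,
          Fin.insertNth_apply_succAbove]
        have hD : divDensity (vec F) K ≤ 3 := by
          by_contra! hlt
          exact hF ⟨vec F, hvec F, hvec3 F, hlt⟩
        rw [le_div_iff₀ (by positivity), mul_comm]
        refine le_trans ?_ hD
        rw [divDensity]
        gcongr
        exact pr_mono fun ε hε => hε ▸ dvd_zero _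
    _ = _ := by rw [sum_const, card_univ, Fintype.card_fin, nsmul_eq_mul]; push_cast; rfl

end Singularity

section Asymptotics

lemma exists_forall_sq_mul_pow_le_one {r : ℝ} (hr0 : 0 ≤ r) (hr : r < 1) :
    ∃ n₀ : ℕ, ∀ n, n₀ ≤ n → 12 * (n : ℝ) ^ 2 * r ^ n ≤ 1 := by
  have h := (tendsto_pow_const_mul_const_pow_of_abs_lt_one 2
    (by rwa [abs_of_nonneg hr0])).const_mul 12
  rw [mul_zero] at h
  obtain ⟨n₀, hn₀⟩ := Filter.eventually_atTop.mp (h.eventually_le_const one_pos)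
  exact ⟨n₀, fun n hn => by rw [mul_assoc]; exact hn₀ n hn⟩

lemma exists_sparsity_parameters {ε : ℝ} (hε : 0 < ε) :
    ∃ (c : ℝ) (C : ℕ), 0 < c ∧ c ≤ 1 ∧ 1 + 2 * c ≤ 2 ^ (ε / 4) ∧ 4 ≤ C ∧ 20 ≤ ε * C ∧
      c⁻¹ ≤ (2 : ℝ) ^ (ε * C / 4) := by
  have h1 : (1 : ℝ) < 2 ^ (ε / 4) := Real.one_lt_rpow one_lt_two (by positivity)
  set c : ℝ := min 1 ((2 ^ (ε / 4) - 1) / 2) with hc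
  have hc0 : 0 < c := lt_min one_pos (by linarith)
  have hc2 : c ≤ (2 ^ (ε / 4) - 1) / 2 := min_le_right _ _
  obtain ⟨C, hC⟩ := exists_nat_ge (max 4 (max (20 / ε) (4 * Real.logb 2 c⁻¹ / ε)))
  simp only [max_le_iff] at hC
  obtain ⟨hC4, hC20, hCl⟩ := hC
  rw [div_le_iff₀' hε] at hC20 hCl
  refine ⟨c, C, hc0, min_le_left _ _, by linarith, by exact_mod_cast hC4, hC20, ?_⟩
  calc c⁻¹ = 2 ^ Real.logb 2 c⁻¹ := (Real.rpow_logb two_pos (by norm_num) (by positivity)).symm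
    _ ≤ _ := Real.rpow_le_rpow_of_exponent_le one_le_two (by linarith)

/-- The singularity probability of a random sign matrix, over the integers. -/
theorem exists_pr_det_eq_zero_le {ε : ℝ} (hε : 0 < ε) (hε1 : ε ≤ 1) :
    ∃ n₀ : ℕ, ∀ n, n₀ ≤ n →
      pr (fun E : Fin n → Fin n → Bool => (Matrix.of fun i j => sgn (E i j)).det = 0) ≤
        2 ^ ((-1 + ε) * n) := by
  obtain ⟨c, C, hc, hc1, hcε, hC4, hC20, hCc⟩ := exists_sparsity_parameters hε
  obtain ⟨n₁, hn₁⟩ := exists_pr_concentrated_le (2 * C) (A := 36) (by norm_num)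
  obtain ⟨n₂, hn₂⟩ := exists_forall_sq_mul_pow_le_one (r := 2 ^ (-(ε / 2))) (by positivity)
    (Real.rpow_lt_one_of_one_lt_of_neg one_lt_two (by linarith))
  refine ⟨max C (max n₁ n₂), fun n hn => ?_⟩
  simp only [max_le_iff] at hn
  obtain ⟨hnC, hnn₁, hnn₂⟩ := hn
  obtain ⟨m, rfl⟩ : ∃ m, n = m + 1 := ⟨n - 1, by omega⟩
  have hbound := hn₂ _ hnn₂
  have hn1 : (1 : ℝ) ≤ ((m + 1 : ℕ) : ℝ) := by exact_mod_cast Nat.le_add_left 1 m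
  have hmn : ((m : ℝ) + 1) = ((m + 1 : ℕ) : ℝ) := by push_cast; rfl
  have hhalf : (1 / 2 : ℝ) ^ m = 2 * 2 ^ (-((m + 1 : ℕ) : ℝ)) := by
    rw [Real.rpow_neg two_pos.le, Real.rpow_natCast, pow_succ]
    field_simp
    simp
  have hhalf' : (1 / 2 : ℝ) ^ (m + 1) = 2 ^ (-((m + 1 : ℕ) : ℝ)) := by
    rw [Real.rpow_neg two_pos.le, Real.rpow_natCast, one_div, inv_pow]
  generalize hN : ((m + 1 : ℕ) : ℝ) = N at *
  set s := (m + 1) / C with hs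
  have hsC : C * s ≤ m + 1 := Nat.mul_div_le _ _
  have hsn : m + 1 ≤ 2 * C * s := by
    have h1 : m + 1 < C * (s + 1) := Nat.lt_mul_div_succ _ (by omega)
    have h2 : 1 ≤ s := (Nat.one_le_div_iff (by omega)).mpr hnC
    nlinarith
  have h4s : 4 * s ≤ m + 1 := (Nat.mul_le_mul_right s hC4).trans hsC
  have hsC' : (C : ℝ) * s ≤ N := by rw [← hN]; exact_mod_cast hsC
  obtain ⟨K, hKX, hXK⟩ := exists_nat_pow_near (x := (2 : ℝ) ^ ((1 - ε / 2) * N)) (y := 3)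
    (Real.one_le_rpow one_le_two (by nlinarith)) (by norm_num)
  have hmod : ∀ k ≤ K, 3 ^ k * 2 ^ (5 * s) ≤ 2 ^ (m + 1) := fun k hk => by
    have h5 : (2 : ℝ) ^ (5 * s) ≤ 2 ^ (ε / 4 * N) := by
      rw [← Real.rpow_natCast]
      refine Real.rpow_le_rpow_of_exponent_le one_le_two ?_
      push_cast
      nlinarith [(Nat.cast_nonneg s : (0 : ℝ) ≤ s)]
    have h6 : (3 : ℝ) ^ k * 2 ^ (5 * s) ≤ 2 ^ (m + 1) :=
      calc (3 : ℝ) ^ k * 2 ^ (5 * s) ≤ 3 ^ K * 2 ^ (5 * s) := by gcongr; norm_num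
        _ ≤ 2 ^ ((1 - ε / 2) * N) * 2 ^ (ε / 4 * N) := by gcongr
        _ = 2 ^ ((1 - ε / 2) * N + ε / 4 * N) := (Real.rpow_add two_pos _ _).symm
        _ ≤ 2 ^ N := Real.rpow_le_rpow_of_exponent_le one_le_two (by nlinarith)
        _ = 2 ^ (m + 1) := by rw [← hN, Real.rpow_natCast]
    exact_mod_cast h6
  have hK3 : 3 ^ K ≤ 2 ^ (m + 1) :=
    (Nat.le_mul_of_pos_right _ (by positivity)).trans (hmod K le_rfl)
  have hKN : (K : ℝ) ≤ N := by
    rw [← hN]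
    exact_mod_cast (Nat.pow_le_pow_iff_right one_lt_two).mp
      ((Nat.pow_le_pow_left (by norm_num) K).trans hK3)
  have hsparse : (1 + 2 * c) ^ (m + 1) / c ^ s ≤ 2 ^ (ε / 2 * N) := by
    have h1 : (1 + 2 * c) ^ (m + 1) ≤ 2 ^ (ε / 4 * N) :=
      (pow_le_pow_left₀ (by positivity) hcε _).trans_eq
        (by rw [← Real.rpow_natCast, ← Real.rpow_mul two_pos.le, hN])
    have h2 : c⁻¹ ^ s ≤ 2 ^ (ε / 4 * N) := by
      refine (pow_le_pow_left₀ (by positivity) hCc _).trans ?_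
      rw [← Real.rpow_natCast, ← Real.rpow_mul two_pos.le]
      exact Real.rpow_le_rpow_of_exponent_le one_le_two (by nlinarith)
    calc _ = (1 + 2 * c) ^ (m + 1) * c⁻¹ ^ s := by rw [inv_pow, div_eq_mul_inv]
      _ ≤ 2 ^ (ε / 4 * N) * 2 ^ (ε / 4 * N) := by gcongr
      _ = _ := by rw [← Real.rpow_add two_pos]; ring_nf
  have hY : (2 : ℝ) ^ (ε / 2 * N) * 2 ^ (-N) = 2 ^ ((-1 + ε / 2) * N) := by
    rw [← Real.rpow_add two_pos]; ring_nf
  have hYN : (2 : ℝ) ^ (-N) ≤ 2 ^ ((-1 + ε / 2) * N) :=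
    Real.rpow_le_rpow_of_exponent_le one_le_two (by nlinarith)
  have hX : (3 : ℝ) / 3 ^ K ≤ 9 * 2 ^ ((-1 + ε / 2) * N) := by
    have h1 : (2 : ℝ) ^ ((-1 + ε / 2) * N) = (2 ^ ((1 - ε / 2) * N))⁻¹ := by
      rw [← Real.rpow_neg two_pos.le]; ring_nf
    rw [h1, ← div_eq_mul_inv, div_le_div_iff₀ (by positivity) (by positivity)]
    rw [pow_succ] at hXK
    linarith
  have hr : (2 : ℝ) ^ ((-1 + ε / 2) * N) =
      (2 ^ (-(ε / 2)) : ℝ) ^ (m + 1) * 2 ^ ((-1 + ε) * N) := by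
    rw [← Real.rpow_natCast, hN, ← Real.rpow_mul two_pos.le, ← Real.rpow_add two_pos]
    ring_nf
  calc _ ≤ _ := pr_det_eq_zero_le (s := s) hc hc1 hK3 fun k hk =>
        hn₁ _ hnn₁ s k (by have := (mem_Icc.mp hk).1; omega) hsn h4s (hmod k (mem_Icc.mp hk).2)
    _ ≤ N * (2 * 2 ^ ((-1 + ε / 2) * N) + N * 2 ^ ((-1 + ε / 2) * N) +
          9 * 2 ^ ((-1 + ε / 2) * N)) := by
        have h1 : (1 + 2 * c) ^ (m + 1) / c ^ s * (1 / 2) ^ m ≤ 2 * 2 ^ ((-1 + ε / 2) * N) := by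
          rw [hhalf, ← hY, mul_left_comm]
          gcongr
        rw [hmn, hhalf']
        gcongr
    _ ≤ 12 * N ^ 2 * 2 ^ ((-1 + ε / 2) * N) := by
        have h0 : (0 : ℝ) < 2 ^ ((-1 + ε / 2) * N) := by positivity
        have h1 : N * (2 + N + 9) ≤ 12 * N ^ 2 := by nlinarith
        have := mul_le_mul_of_nonneg_right h1 h0.le
        linarith
    _ = 12 * N ^ 2 * (2 ^ (-(ε / 2)) : ℝ) ^ (m + 1) * 2 ^ ((-1 + ε) * N) := by rw [hr]; ring
    _ ≤ 2 ^ ((-1 + ε) * N) := mul_le_of_le_one_left (by positivity) hbound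

end Asymptotics

section Counting

/-- The real sign matrix encoded by a Boolean matrix. -/
def boolMatrix {n : ℕ} (E : Fin n → Fin n → Bool) : Matrix (Fin n) (Fin n) ℝ :=
  (Matrix.of fun i j => sgn (E i j)).map (Int.cast : ℤ → ℝ)

lemma boolMatrix_injective (n : ℕ) : Function.Injective (boolMatrix (n := n)) := by
  intro E F h
  ext i j
  have hij : ((sgn (E i j) : ℤ) : ℝ) = (sgn (F i j) : ℤ) := congrFun (congrFun h i) j
  have hsgn : ∀ a b : Bool, sgn a = sgn b → a = b := by decide
  exact hsgn _ _ (by exact_mod_cast hij)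

lemma det_boolMatrix_eq_zero_iff {n : ℕ} (E : Fin n → Fin n → Bool) :
    (boolMatrix E).det = 0 ↔ (Matrix.of fun i j => sgn (E i j)).det = 0 := by
  rw [boolMatrix, ← Int.cast_det, Int.cast_eq_zero]

lemma image_boolMatrix {n : ℕ} (p : Matrix (Fin n) (Fin n) ℝ → Prop) :
    {B : Matrix (Fin n) (Fin n) ℝ | (∀ i j, B i j = 1 ∨ B i j = -1) ∧ p B} =
      boolMatrix '' {E | p (boolMatrix E)} := by
  ext B
  constructor
  · rintro ⟨hB, hp⟩
    have h : boolMatrix (fun i j => decide (B i j = 1)) = B := by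
      ext i j
      rcases hB i j with h | h <;> (simp [boolMatrix, sgn, h]; try norm_num)
    exact ⟨_, by rwa [← h] at hp, h⟩
  · rintro ⟨E, hE, rfl⟩
    exact ⟨fun i j => by cases h : E i j <;> simp [boolMatrix, sgn, h], hE⟩

lemma ncard_signMatrix_eq {n : ℕ} (p : Matrix (Fin n) (Fin n) ℝ → Prop) :
    ({B : Matrix (Fin n) (Fin n) ℝ | (∀ i j, B i j = 1 ∨ B i j = -1) ∧ p B}.ncard : ℝ) =
      pr (fun E : Fin n → Fin n → Bool => p (boolMatrix E)) *
        Fintype.card (Fin n → Fin n → Bool) := by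
  classical
  rw [image_boolMatrix, Set.ncard_image_of_injective _ (boolMatrix_injective n), pr_eq_card,
    div_mul_cancel₀ _ (by positivity), Set.ncard_eq_toFinset_card']
  simp

end Counting

end SignMatrix

/-- **Tikhomirov's theorem.** For every `ε > 0` and all sufficiently large `n`, an
`n × n` random matrix with independent uniform `{-1,1}` entries is singular with
probability at most `2^{(-1+ε)n}`, formulated by counting: the number of singular sign
matrices is at most `2^{(-1+ε)n}` times the total number `2^{n²}` of sign matrices. -/
theorem tikhomirov_singularity (ε : ℝ) (hε : 0 < ε) :
    ∃ n₀ : ℕ, ∀ n : ℕ, n₀ ≤ n →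
      ({B : Matrix (Fin n) (Fin n) ℝ |
          (∀ i j, B i j = 1 ∨ B i j = -1) ∧ B.det = 0}.ncard : ℝ) ≤
        (2 : ℝ) ^ ((-1 + ε) * n) *
          {B : Matrix (Fin n) (Fin n) ℝ | ∀ i j, B i j = 1 ∨ B i j = -1}.ncard := by
  obtain ⟨n₀, hn₀⟩ := SignMatrix.exists_pr_det_eq_zero_le (lt_min hε one_pos) (min_le_right ε 1)
  refine ⟨n₀, fun n hn => ?_⟩
  have hall := SignMatrix.ncard_signMatrix_eq (n := n) fun _ => True
  have hpr : SignMatrix.pr (fun _ : Fin n → Fin n → Bool => True) = 1 := by simp [SignMatrix.pr]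
  simp only [and_true, hpr, one_mul] at hall
  rw [hall, SignMatrix.ncard_signMatrix_eq]
  simp only [SignMatrix.det_boolMatrix_eq_zero_iff]
  gcongr
  refine (hn₀ n hn).trans (Real.rpow_le_rpow_of_exponent_le one_le_two ?_)
  gcongr
  exact min_le_left _ _
end

section
/- There exists an absolute constant C > 0 such that for every n ≥ 2 and every n × n real matrix A each of whose columns has Euclidean (ℓ₂) norm at most 1, there exists a vector x ∈ {-1, 1}^n with ‖Ax‖_∞ ≤ C √(log n). -/
theorem exp_le_add_exp_sq (t : ℝ) : Real.exp t ≤ t + Real.exp (t ^ 2) := by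
  have h1 := Real.add_one_le_exp (t ^ 2)
  rcases le_or_gt |t| 1 with h | h
  · have := (abs_le.mp (Real.abs_exp_sub_one_sub_id_le h)).2
    linarith
  · rcases lt_abs.mp h with h | h
    · have : Real.exp t ≤ Real.exp (t ^ 2) := Real.exp_le_exp.mpr (by nlinarith)
      linarith
    · have : Real.exp t ≤ 1 := Real.exp_le_one_iff.mpr (by linarith)
      nlinarith

/-- A crude form of Hoeffding's lemma for a `±1`-valued variable of mean `t`. -/
theorem cosh_add_mul_sinh_le {t : ℝ} (ht : t ∈ Set.Icc (-1 : ℝ) 1) (r : ℝ) :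
    Real.cosh r + t * Real.sinh r ≤ Real.exp (t * r + 4 * r ^ 2) := by
  obtain ⟨h1, h2⟩ := ht
  have key : (1 + t) / 2 * Real.exp ((1 - t) * r) + (1 - t) / 2 * Real.exp (-(1 + t) * r)
      ≤ Real.exp (4 * r ^ 2) := by
    have e1 := exp_le_add_exp_sq ((1 - t) * r)
    have e2 := exp_le_add_exp_sq (-(1 + t) * r)
    have e3 : Real.exp (((1 - t) * r) ^ 2) ≤ Real.exp (4 * r ^ 2) :=
      Real.exp_le_exp.mpr (by rw [mul_pow]; gcongr; nlinarith)
    have e4 : Real.exp ((-(1 + t) * r) ^ 2) ≤ Real.exp (4 * r ^ 2) :=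
      Real.exp_le_exp.mpr (by rw [mul_pow]; gcongr; nlinarith)
    have f1 := mul_le_mul_of_nonneg_left (e1.trans (add_le_add_right e3 _))
      (show 0 ≤ (1 + t) / 2 by linarith)
    have f2 := mul_le_mul_of_nonneg_left (e2.trans (add_le_add_right e4 _))
      (show 0 ≤ (1 - t) / 2 by linarith)
    linarith
  have := mul_le_mul_of_nonneg_left key (Real.exp_pos (t * r)).le
  rw [← Real.exp_add, mul_add, mul_left_comm, mul_left_comm (Real.exp (t * r)), ← Real.exp_add,
    ← Real.exp_add] at this
  refine le_trans (le_of_eq ?_) this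
  rw [Real.cosh_eq, Real.sinh_eq, show t * r + (1 - t) * r = r by ring,
    show t * r + -(1 + t) * r = -r by ring]
  ring

theorem cosh_add_mul_sinh_pos {t : ℝ} (ht : t ∈ Set.Icc (-1 : ℝ) 1) (r : ℝ) :
    0 < Real.cosh r + t * Real.sinh r := by
  obtain ⟨h1, h2⟩ := ht
  rw [Real.cosh_eq, Real.sinh_eq]
  have e1 := Real.exp_pos r
  have e2 := Real.exp_pos (-r)
  rcases le_total t 0 with h | h <;> nlinarith

theorem ConcaveOn.rpow_mul_rpow {s : Set ℝ} {f g : ℝ → ℝ} (hf : ConcaveOn ℝ s f)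
    (hg : ConcaveOn ℝ s g) (hf0 : ∀ t ∈ s, 0 < f t) (hg0 : ∀ t ∈ s, 0 < g t) {a b : ℝ}
    (ha : 0 ≤ a) (hb : 0 ≤ b) (hab : a + b = 1) :
    ConcaveOn ℝ s fun t ↦ f t ^ a * g t ^ b := by
  refine ⟨hf.1, fun x hx y hy p q hp hq hpq ↦ ?_⟩
  have hz := hf.1 hx hy hp hq hpq
  have cf := hf.2 hx hy hp hq hpq
  have cg := hg.2 hx hy hp hq hpq
  simp only [smul_eq_mul] at *
  set z := p * x + q * y
  have Fz := hf0 z hz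
  have Gz := hg0 z hz
  have amgm : ∀ w ∈ s, f w ^ a * g w ^ b ≤
      (a * (f w / f z) + b * (g w / g z)) * (f z ^ a * g z ^ b) := by
    intro w hw
    have := Real.geom_mean_le_arith_mean2_weighted ha hb (div_pos (hf0 w hw) Fz).le
      (div_pos (hg0 w hw) Gz).le hab
    rw [Real.div_rpow (hf0 w hw).le Fz.le, Real.div_rpow (hg0 w hw).le Gz.le,
      div_mul_div_comm, div_le_iff₀ (by positivity)] at this
    exact this
  have h1 := mul_le_mul_of_nonneg_left (amgm x hx) hp
  have h2 := mul_le_mul_of_nonneg_left (amgm y hy) hq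
  have h3 : (p * (a * (f x / f z) + b * (g x / g z)) + q * (a * (f y / f z) + b * (g y / g z)))
      ≤ 1 := by
    have e : (p * (a * (f x / f z) + b * (g x / g z)) + q * (a * (f y / f z) + b * (g y / g z)))
      = a * ((p * f x + q * f y) / f z) + b * ((p * g x + q * g y) / g z) := by ring
    rw [e, ← hab]
    have i1 := mul_le_mul_of_nonneg_left ((div_le_one Fz).mpr cf) ha
    have i2 := mul_le_mul_of_nonneg_left ((div_le_one Gz).mpr cg) hb
    linarith
  have h4 := mul_le_mul_of_nonneg_right h3 (show 0 ≤ f z ^ a * g z ^ b by positivity)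
  linarith

theorem ConcaveOn.rpow_of_pos {s : Set ℝ} {f : ℝ → ℝ} (hf : ConcaveOn ℝ s f)
    (hf0 : ∀ t ∈ s, 0 < f t) {a : ℝ} (ha : 0 ≤ a) (ha1 : a ≤ 1) :
    ConcaveOn ℝ s fun t ↦ f t ^ a := by
  simpa using hf.rpow_mul_rpow (concaveOn_const 1 hf.1) hf0 (fun _ _ ↦ one_pos) ha
    (sub_nonneg.mpr ha1) (by ring)

section Projection

variable {E : Type*} [NormedAddCommGroup E] [InnerProductSpace ℝ E] [FiniteDimensional ℝ E]

theorem norm_sq_sub_starProjection (K : Submodule ℝ E) (u : E) :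
    ‖u - K.starProjection u‖ ^ 2 = ‖u‖ ^ 2 - ‖K.starProjection u‖ ^ 2 := by
  have := Submodule.norm_sq_eq_add_norm_sq_starProjection u K
  rw [← Submodule.starProjection_orthogonal_val]
  linarith

theorem Submodule.starProjection_starProjection_of_le {K K' : Submodule ℝ E} (h : K' ≤ K) (u : E) :
    K'.starProjection (K.starProjection u) = K'.starProjection u :=
  congrArg (fun f ↦ f u) (Submodule.starProjection_comp_starProjection_of_le h)

theorem norm_sq_starProjection_sub_of_le {K K' : Submodule ℝ E} (h : K' ≤ K) (u : E) :
    ‖K.starProjection u - K'.starProjection u‖ ^ 2 =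
      ‖K.starProjection u‖ ^ 2 - ‖K'.starProjection u‖ ^ 2 := by
  have := norm_sq_sub_starProjection K' (K.starProjection u)
  rwa [Submodule.starProjection_starProjection_of_le h] at this

theorem norm_starProjection_mono {K K' : Submodule ℝ E} (h : K' ≤ K) (u : E) :
    ‖K'.starProjection u‖ ^ 2 ≤ ‖K.starProjection u‖ ^ 2 := by
  have := norm_sq_starProjection_sub_of_le h u
  nlinarith [sq_nonneg ‖K.starProjection u - K'.starProjection u‖]

theorem inner_starProjection_sub_sq_le {K K' : Submodule ℝ E} (h : K' ≤ K) (u θ : E) :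
    inner ℝ (K.starProjection u - K'.starProjection u) θ ^ 2 ≤
      ‖K.starProjection u - K'.starProjection u‖ ^ 2 *
        (‖K.starProjection θ‖ ^ 2 - ‖K'.starProjection θ‖ ^ 2) := by
  rw [← norm_sq_starProjection_sub_of_le h θ, ← mul_pow]
  have e : inner ℝ (K.starProjection u - K'.starProjection u) θ =
      inner ℝ (K.starProjection u - K'.starProjection u)
        (K.starProjection θ - K'.starProjection θ) := by
    have h1 : K.starProjection (K.starProjection u - K'.starProjection u) =
        K.starProjection u - K'.starProjection u := by
      rw [Submodule.starProjection_eq_self_iff]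
      exact K.sub_mem (K.starProjection_apply_mem u) (h (K'.starProjection_apply_mem u))
    have h2 : K'.starProjection (K.starProjection u - K'.starProjection u) = 0 := by
      rw [map_sub, Submodule.starProjection_starProjection_of_le h,
        Submodule.starProjection_starProjection_of_le le_rfl, sub_self]
    rw [inner_sub_right, ← Submodule.inner_starProjection_left_eq_right K, h1,
      ← Submodule.inner_starProjection_left_eq_right K', h2, inner_zero_left, sub_zero]
  rw [e]
  exact sq_le_sq.mpr ((abs_real_inner_le_norm _ _).trans (le_abs_self _))

/-- `H` is a positive concave profile on `[-1, 1]` whose power `‖u - P_K u‖ ^ 2` dominates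
`t ↦ exp (t ⟪u - P_K u, θ⟫)` at `t = ±1`. -/
structure IsProfile (K : Submodule ℝ E) (u θ : E) (H : ℝ → ℝ) : Prop where
  concave : ConcaveOn ℝ (Set.Icc (-1) 1) H
  pos : ∀ t ∈ Set.Icc (-1 : ℝ) 1, 0 < H t
  right : Real.exp (inner ℝ (u - K.starProjection u) θ) ≤ H 1 ^ (‖u - K.starProjection u‖ ^ 2)
  left : Real.exp (-inner ℝ (u - K.starProjection u) θ) ≤ H (-1) ^ (‖u - K.starProjection u‖ ^ 2)

/-- The potential of a pivot `u` with coefficient `t`, where `K` is the span of the other alive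
vectors. -/
noncomputable def pivotPotential (K : Submodule ℝ E) (u θ : E) (H : ℝ → ℝ) (t : ℝ) : ℝ :=
  H t ^ (‖u - K.starProjection u‖ ^ 2) *
    Real.exp (-(t * inner ℝ (u - K.starProjection u) θ) + 4 * ‖K.starProjection θ‖ ^ 2)

theorem isProfile_one {K : Submodule ℝ E} {u : E} (hu : u ∈ K) (θ : E) :
    IsProfile K u θ fun _ ↦ 1 := by
  have : K.starProjection u = u := Submodule.starProjection_eq_self_iff.mpr hu
  exact ⟨concaveOn_const 1 (convex_Icc _ _), fun _ _ ↦ one_pos, by simp [this], by simp [this]⟩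

theorem pivotPotential_one {K : Submodule ℝ E} {u : E} (hu : u ∈ K) (θ : E) (t : ℝ) :
    pivotPotential K u θ (fun _ ↦ 1) t = Real.exp (4 * ‖K.starProjection θ‖ ^ 2) := by
  have : K.starProjection u = u := Submodule.starProjection_eq_self_iff.mpr hu
  simp [pivotPotential, this]

/-- Shrinking the span of the alive vectors never increases the potential, after a suitable
change of profile. -/
theorem IsProfile.exists_of_le {K K' : Submodule ℝ E} (h : K' ≤ K) {u θ : E} {H : ℝ → ℝ}
    (hH : IsProfile K u θ H) :
    ∃ H', IsProfile K' u θ H' ∧ ∀ t ∈ Set.Icc (-1 : ℝ) 1,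
      pivotPotential K' u θ H' t ≤ pivotPotential K u θ H t := by
  obtain ⟨hc, hp, hr, hl⟩ := hH
  set η := K.starProjection u - K'.starProjection u with hη
  have hγ : ‖u - K'.starProjection u‖ ^ 2 = ‖u - K.starProjection u‖ ^ 2 + ‖η‖ ^ 2 := by
    rw [norm_sq_sub_starProjection, norm_sq_sub_starProjection, hη,
      norm_sq_starProjection_sub_of_le h]
    ring
  have hα : inner ℝ (u - K'.starProjection u) θ =
      inner ℝ (u - K.starProjection u) θ + inner ℝ η θ := by
    rw [← inner_add_left, hη]
    congr 1
    abel
  have hb := inner_starProjection_sub_sq_le h u θ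
  have hmono := norm_starProjection_mono h θ
  rw [← hη] at hb
  set γ := ‖u - K.starProjection u‖ ^ 2 with hγdef
  set α := inner ℝ (u - K.starProjection u) θ
  have hγ0 : 0 ≤ γ := sq_nonneg _
  have hΔ0 : 0 ≤ ‖η‖ ^ 2 := sq_nonneg _
  by_cases hz : ‖η‖ ^ 2 = 0
  · have hη0 : η = 0 := by simpa using hz
    have ha : inner ℝ η θ = 0 := by rw [hη0, inner_zero_left]
    rw [hz, add_zero] at hγ
    rw [ha, add_zero] at hα
    refine ⟨H, ⟨hc, hp, by rwa [hγ, hα], by rwa [hγ, hα]⟩, fun t ht ↦ ?_⟩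
    unfold pivotPotential
    rw [hγ, hα]
    have := hp t ht
    gcongr
  set Δ := ‖η‖ ^ 2
  set a := inner ℝ η θ
  have hΔ : 0 < Δ := lt_of_le_of_ne hΔ0 (Ne.symm hz)
  have hγ' : 0 < γ + Δ := by linarith
  set r := a / Δ with hrdef
  have hrΔ : r * Δ = a := div_mul_cancel₀ a hz
  let ℓ : ℝ → ℝ := fun t ↦ Real.cosh r + t * Real.sinh r
  have hℓ0 : ∀ t ∈ Set.Icc (-1 : ℝ) 1, 0 < ℓ t := fun t ht ↦ cosh_add_mul_sinh_pos ht r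
  have hℓc : ConcaveOn ℝ (Set.Icc (-1) 1) ℓ := by
    refine ⟨convex_Icc _ _, fun x _ y _ p q _ _ hpq ↦ le_of_eq ?_⟩
    simp only [ℓ, smul_eq_mul]
    linear_combination hpq * Real.cosh r
  let H' : ℝ → ℝ := fun t ↦ H t ^ (γ / (γ + Δ)) * ℓ t ^ (Δ / (γ + Δ))
  have hH' : ∀ t ∈ Set.Icc (-1 : ℝ) 1, H' t ^ (γ + Δ) = H t ^ γ * ℓ t ^ Δ := by
    intro t ht
    have h1 := hp t ht
    have h2 := hℓ0 t ht
    simp only [H']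
    rw [Real.mul_rpow (by positivity) (by positivity), ← Real.rpow_mul h1.le,
      ← Real.rpow_mul h2.le, div_mul_cancel₀ _ hγ'.ne', div_mul_cancel₀ _ hγ'.ne']
  have m1 : (1 : ℝ) ∈ Set.Icc (-1 : ℝ) 1 := by norm_num
  have m2 : (-1 : ℝ) ∈ Set.Icc (-1 : ℝ) 1 := by norm_num
  refine ⟨H', ⟨?_, ?_, ?_, ?_⟩, fun t ht ↦ ?_⟩
  · exact hc.rpow_mul_rpow hℓc hp hℓ0 (by positivity) (by positivity) (by field_simp)
  · intro t ht
    have h1 := hp t ht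
    have h2 := hℓ0 t ht
    positivity
  · rw [hγ, hα, hH' 1 m1, Real.exp_add]
    have : ℓ 1 = Real.exp r := by simp [ℓ, Real.cosh_add_sinh]
    rw [this, ← Real.exp_mul, hrΔ]
    gcongr
  · rw [hγ, hα, hH' _ m2, neg_add, Real.exp_add]
    have : ℓ (-1) = Real.exp (-r) := by
      simp only [ℓ, neg_one_mul, ← sub_eq_add_neg, Real.cosh_sub_sinh]
    rw [this, ← Real.exp_mul, neg_mul, hrΔ]
    gcongr
  · unfold pivotPotential
    rw [hγ, hα, hH' t ht]
    have h1 := hp t ht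
    have h2 := hℓ0 t ht
    have h3 : ℓ t ^ Δ ≤ Real.exp ((t * r + 4 * r ^ 2) * Δ) := by
      rw [Real.exp_mul]
      exact Real.rpow_le_rpow h2.le (cosh_add_mul_sinh_le ht r) hΔ0
    have h4 : r ^ 2 * Δ ≤ ‖K.starProjection θ‖ ^ 2 - ‖K'.starProjection θ‖ ^ 2 := by
      have : r ^ 2 * Δ * Δ = a ^ 2 := by rw [← hrΔ]; ring
      exact le_of_mul_le_mul_right (by linarith) hΔ
    rw [mul_assoc]
    refine mul_le_mul_of_nonneg_left ?_ (by positivity)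
    refine (mul_le_mul_of_nonneg_right h3 (Real.exp_pos _).le).trans ?_
    rw [← Real.exp_add, Real.exp_le_exp]
    have : t * r * Δ = t * a := by rw [mul_assoc, hrΔ]
    linarith

end Projection

/-- Moving along `u` inside the open cube, one eventually hits its boundary. -/
theorem exists_pos_forall_abs_le_one {ι : Type*} {A : Finset ι} {x u : ι → ℝ}
    (hx : ∀ i ∈ A, |x i| < 1) {p : ι} (hp : p ∈ A) (hu : |u p| = 1) :
    ∃ δ : ℝ, 0 < δ ∧ (∀ i ∈ A, |x i + δ * u i| ≤ 1) ∧ ∃ i ∈ A, |x i + δ * u i| = 1 := by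
  have hA : A.Nonempty := ⟨p, hp⟩
  let φ : ℝ → ℝ := fun δ ↦ A.sup' hA fun i ↦ |x i + δ * u i|
  have hφ : Continuous φ := Continuous.finset_sup'_apply hA fun i _ ↦ by fun_prop
  have h0 : φ 0 < 1 := by
    simp only [φ, Finset.sup'_lt_iff]
    simpa using hx
  have h2 : 1 ≤ φ 2 := by
    refine le_trans ?_ (Finset.le_sup' (fun i ↦ |x i + 2 * u i|) hp)
    have h3 := abs_sub_abs_le_abs_sub (2 * u p) (-x p)
    rw [abs_mul, hu, abs_neg, abs_two, sub_neg_eq_add, add_comm (2 * u p)] at h3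
    have := hx p hp
    linarith
  obtain ⟨δ, hδ, hδ1⟩ := intermediate_value_Icc (show (0 : ℝ) ≤ 2 by norm_num) hφ.continuousOn
    ⟨h0.le, h2⟩
  refine ⟨δ, lt_of_le_of_ne hδ.1 ?_, fun i hi ↦ ?_, ?_⟩
  · rintro rfl
    exact h0.ne hδ1
  · exact hδ1 ▸ Finset.le_sup' (fun i ↦ |x i + δ * u i|) hi
  · obtain ⟨i, hi, h⟩ := Finset.exists_mem_eq_sup' hA fun i ↦ |x i + δ * u i|
    exact ⟨i, hi, h ▸ hδ1⟩

theorem concaveOn_sum_mul {J : Type*} [Fintype J] {s : Set ℝ} (hs : Convex ℝ s) {c : J → ℝ}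
    {f : J → ℝ → ℝ} (hc : ∀ j, 0 ≤ c j) (hf : ∀ j, ConcaveOn ℝ s (f j)) :
    ConcaveOn ℝ s fun t ↦ ∑ j, c j * f j t := by
  refine ⟨hs, fun x hx y hy a b ha hb hab ↦ ?_⟩
  simp only [smul_eq_mul, Finset.mul_sum, ← Finset.sum_add_distrib]
  refine Finset.sum_le_sum fun j _ ↦ ?_
  have := mul_le_mul_of_nonneg_left ((hf j).2 hx hy ha hb hab) (hc j)
  simp only [smul_eq_mul] at this
  linarith

section Walk

variable {E : Type*} [NormedAddCommGroup E] [InnerProductSpace ℝ E]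
variable {ι J : Type*} [Fintype ι] [Fintype J]

/-- Some sign vector `y` does no worse than `b` for the exponential moments of `∑ i, y i • v i`. -/
def HasSigning (v : ι → E) (θ : J → E) (b : ℝ) : Prop :=
  ∃ y : ι → ℝ, (∀ i, |y i| = 1) ∧ ∑ j, Real.exp (inner ℝ (∑ i, y i • v i) (θ j)) ≤ b

theorem HasSigning.mono {v : ι → E} {θ : J → E} {b c : ℝ} (h : HasSigning v θ b) (hbc : b ≤ c) :
    HasSigning v θ c := by
  obtain ⟨y, hy, h⟩ := h
  exact ⟨y, hy, h.trans hbc⟩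

variable [FiniteDimensional ℝ E]

/-- Every fractional colouring with alive set `A` can be rounded within the potential given
by any pivot and any profiles. -/
def RoundsWithPivot (v : ι → E) (θ : J → E) (A : Finset ι) : Prop :=
  ∀ x : ι → ℝ, (∀ i ∈ A, |x i| < 1) → (∀ i ∉ A, |x i| = 1) →
    ∀ p ∈ A, ∀ H : J → ℝ → ℝ,
      (∀ j, IsProfile (Submodule.span ℝ (v '' (A \ {p} : Set ι))) (v p) (θ j) (H j)) →
      HasSigning v θ (∑ j, Real.exp (inner ℝ (∑ i, x i • v i) (θ j)) *
        pivotPotential (Submodule.span ℝ (v '' (A \ {p} : Set ι))) (v p) (θ j) (H j) (x p))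

/-- If all pivots work, then one may start without a pivot. -/
theorem RoundsWithPivot.hasSigning {v : ι → E} {θ : J → E} {A : Finset ι}
    (hA : A.Nonempty → RoundsWithPivot v θ A) {x : ι → ℝ} (hx : ∀ i ∈ A, |x i| < 1)
    (hx' : ∀ i ∉ A, |x i| = 1) :
    HasSigning v θ (∑ j, Real.exp (inner ℝ (∑ i, x i • v i) (θ j)) *
      Real.exp (4 * ‖(Submodule.span ℝ (v '' (A : Set ι))).starProjection (θ j)‖ ^ 2)) := by
  rcases A.eq_empty_or_nonempty with rfl | hne
  · refine ⟨x, fun i ↦ hx' i (Finset.notMem_empty i), Finset.sum_le_sum fun j _ ↦ ?_⟩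
    exact le_mul_of_one_le_right (Real.exp_pos _).le (Real.one_le_exp (by positivity))
  obtain ⟨p, hp⟩ := hne
  have hvp : v p ∈ Submodule.span ℝ (v '' (A : Set ι)) :=
    Submodule.subset_span (Set.mem_image_of_mem v (Finset.mem_coe.mpr hp))
  have hle : Submodule.span ℝ (v '' (A \ {p} : Set ι)) ≤ Submodule.span ℝ (v '' (A : Set ι)) :=
    Submodule.span_mono (Set.image_mono Set.sdiff_subset)
  choose H hH hH' using fun j ↦ (isProfile_one hvp (θ j)).exists_of_le hle
  refine (hA ⟨p, hp⟩ x hx hx' p hp H hH).mono (Finset.sum_le_sum fun j _ ↦ ?_)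
  have := hH' j (x p) (abs_le.mp (hx p hp).le)
  rw [pivotPotential_one hvp] at this
  gcongr

theorem exists_pivot_direction (v : ι → E) (A : Finset ι) {p : ι} (hp : p ∈ A) :
    ∃ u : ι → ℝ, u p = 1 ∧ (∀ i ∉ A, u i = 0) ∧ ∑ i, u i • v i =
      v p - (Submodule.span ℝ (v '' (A \ {p} : Set ι))).starProjection (v p) := by
  classical
  set K := Submodule.span ℝ (v '' (A \ {p} : Set ι)) with hK
  have hmem : K.starProjection (v p) ∈ K := K.starProjection_apply_mem _
  rw [show (A \ {p} : Set ι) = ((A.erase p : Finset ι) : Set ι) by simp] at hK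
  have hmem' := hmem
  rw [hK, Submodule.mem_span_image_finset_iff_exists_fun'] at hmem'
  obtain ⟨c, hc⟩ := hmem'
  rw [← hK] at hc
  refine ⟨fun i ↦ if i = p then 1 else if i ∈ A then -c i else 0, by simp, fun i hi ↦ ?_, ?_⟩
  · have : i ≠ p := by rintro rfl; exact hi hp
    simp [this, hi]
  · rw [← hc, ← Finset.add_sum_erase Finset.univ _ (Finset.mem_univ p), sub_eq_add_neg]
    congr 1
    · simp
    · rw [← Finset.sum_neg_distrib]
      symm
      refine Finset.sum_subset_zero_on_sdiff
        (Finset.erase_subset_erase p (Finset.subset_univ A)) ?_ ?_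
      · intro i hi
        simp only [Finset.mem_sdiff, Finset.mem_erase, Finset.mem_univ, and_true] at hi
        have : i ∉ A := fun h ↦ hi.2 ⟨hi.1, h⟩
        simp [hi.1, this]
      · intro i hi
        rw [Finset.mem_erase] at hi
        simp [hi.1, hi.2]

/-- After a step of the walk that freezes a coordinate, the induction hypothesis applies. -/
theorem RoundsWithPivot.hasSigning_step {v : ι → E} {θ : J → E} {A : Finset ι}
    (ih : ∀ B ⊂ A, RoundsWithPivot v θ B) {x : ι → ℝ} (hx : ∀ i ∈ A, |x i| ≤ 1)
    (hx' : ∀ i ∉ A, |x i| = 1) (hfreeze : ∃ i ∈ A, |x i| = 1) {p : ι} (hp : p ∈ A)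
    {H : J → ℝ → ℝ}
    (hH : ∀ j, IsProfile (Submodule.span ℝ (v '' (A \ {p} : Set ι))) (v p) (θ j) (H j)) :
    HasSigning v θ (∑ j, Real.exp (inner ℝ (∑ i, x i • v i) (θ j)) *
      pivotPotential (Submodule.span ℝ (v '' (A \ {p} : Set ι))) (v p) (θ j) (H j) (x p)) := by
  classical
  set B := A.filter fun i ↦ |x i| < 1 with hB
  have hBA : B ⊂ A := by
    obtain ⟨i, hi, hi1⟩ := hfreeze
    exact Finset.filter_ssubset.mpr ⟨i, hi, by simp [hi1]⟩
  have hxB : ∀ i ∈ B, |x i| < 1 := fun i hi ↦ (Finset.mem_filter.mp hi).2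
  have hxB' : ∀ i ∉ B, |x i| = 1 := by
    intro i hi
    by_cases hiA : i ∈ A
    · refine le_antisymm (hx i hiA) (not_lt.mp fun h ↦ hi (Finset.mem_filter.mpr ⟨hiA, h⟩))
    · exact hx' i hiA
  by_cases hpB : p ∈ B
  · have hle : Submodule.span ℝ (v '' (B \ {p} : Set ι)) ≤
        Submodule.span ℝ (v '' (A \ {p} : Set ι)) :=
      Submodule.span_mono (Set.image_mono (Set.sdiff_subset_sdiff_left
        (Finset.coe_subset.mpr hBA.subset)))
    choose H' hH' hle' using fun j ↦ (hH j).exists_of_le hle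
    refine (ih B hBA x hxB hxB' p hpB H' hH').mono (Finset.sum_le_sum fun j _ ↦ ?_)
    have := hle' j (x p) (abs_le.mp (hx p hp))
    gcongr
  · have hle : Submodule.span ℝ (v '' (B : Set ι)) ≤
        Submodule.span ℝ (v '' (A \ {p} : Set ι)) := by
      refine Submodule.span_mono (Set.image_mono fun i hi ↦ ⟨hBA.subset hi, ?_⟩)
      rintro rfl
      exact hpB hi
    refine (RoundsWithPivot.hasSigning (fun _ ↦ ih B hBA) hxB hxB').mono
      (Finset.sum_le_sum fun j _ ↦ mul_le_mul_of_nonneg_left ?_ (Real.exp_pos _).le)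
    have hmono := norm_starProjection_mono hle (θ j)
    unfold pivotPotential
    set K := Submodule.span ℝ (v '' (A \ {p} : Set ι))
    have h1 : Real.exp (x p * inner ℝ (v p - K.starProjection (v p)) (θ j)) ≤
        H j (x p) ^ (‖v p - K.starProjection (v p)‖ ^ 2) := by
      rcases eq_or_eq_neg_of_abs_eq (hxB' p hpB) with h | h
      · simpa [h] using (hH j).right
      · simpa [h] using (hH j).left
    refine le_trans ?_ (mul_le_mul_of_nonneg_right h1 (Real.exp_pos _).le)
    rw [← Real.exp_add, Real.exp_le_exp]
    linarith

theorem roundsWithPivot {v : ι → E} (hv : ∀ i, ‖v i‖ ≤ 1) (θ : J → E) (A : Finset ι) :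
    RoundsWithPivot v θ A := by
  induction A using Finset.strongInduction with
  | H A ih =>
  intro x hx hx' p hp H hH
  obtain ⟨u, hup, huA, hu⟩ := exists_pivot_direction v A hp
  obtain ⟨δ, hδ, hδ1, hδ2⟩ := exists_pos_forall_abs_le_one hx hp (u := u) (by simp [hup])
  obtain ⟨ε, hε, hε1, hε2⟩ := exists_pos_forall_abs_le_one hx hp (u := -u) (by simp [hup])
  set K := Submodule.span ℝ (v '' (A \ {p} : Set ι)) with hK
  set w := v p - K.starProjection (v p) with hw
  have hw1 : ‖w‖ ^ 2 ≤ 1 := by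
    rw [hw, norm_sq_sub_starProjection]
    nlinarith [hv p, norm_nonneg (v p), sq_nonneg ‖K.starProjection (v p)‖]
  let c : J → ℝ := fun j ↦ Real.exp (inner ℝ (∑ i, x i • v i) (θ j)) *
    Real.exp (-(x p * inner ℝ w (θ j)) + 4 * ‖K.starProjection (θ j)‖ ^ 2)
  let g : ℝ → ℝ := fun t ↦ ∑ j, c j * H j t ^ (‖w‖ ^ 2)
  have hg : ConcaveOn ℝ (Set.Icc (-1) 1) g := by
    refine concaveOn_sum_mul (convex_Icc _ _) (fun j ↦ by positivity) fun j ↦ ?_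
    exact (hH j).concave.rpow_of_pos (hH j).pos (sq_nonneg _) hw1
  have hstep : ∀ s : ℝ, (∀ i ∈ A, |x i + s * u i| ≤ 1) → (∃ i ∈ A, |x i + s * u i| = 1) →
      HasSigning v θ (g (x p + s)) := by
    intro s hs1 hs2
    refine (RoundsWithPivot.hasSigning_step ih (x := fun i ↦ x i + s * u i) hs1
      (fun i hi ↦ by simp [huA i hi, hx' i hi]) hs2 hp hH).mono
        (Finset.sum_le_sum fun j _ ↦ le_of_eq ?_)
    have e : ∑ i, (x i + s * u i) • v i = ∑ i, x i • v i + s • w := by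
      rw [← hu, Finset.smul_sum, ← Finset.sum_add_distrib]
      simp only [add_smul, mul_smul]
    simp only [pivotPotential, ← hK, ← hw, hup, mul_one, c]
    rw [e, inner_add_left, real_inner_smul_left, mul_left_comm, ← Real.exp_add, mul_comm,
      ← Real.exp_add]
    congr 2
    ring
  have htarget : ∑ j, Real.exp (inner ℝ (∑ i, x i • v i) (θ j)) *
      pivotPotential K (v p) (θ j) (H j) (x p) = g (x p) := by
    refine Finset.sum_congr rfl fun j _ ↦ ?_
    simp only [pivotPotential, c, ← hw]
    ring
  rw [htarget]
  have h1 : |x p + δ| ≤ 1 := by simpa [hup] using hδ1 p hp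
  have h2 : |x p + -ε| ≤ 1 := by simpa [hup] using hε1 p hp
  have hmin := hg.min_le_of_mem_Icc (z := x p) (abs_le.mp h2) (abs_le.mp h1)
    ⟨by linarith, by linarith⟩
  rcases min_le_iff.mp hmin with h | h
  · exact (hstep (-ε) (by simpa using hε1) (by simpa using hε2)).mono h
  · exact (hstep δ hδ1 hδ2).mono h

/-- A finite family of vectors in the unit ball has a signed sum whose exponential moments along
prescribed directions are subgaussian on average. -/
theorem exists_signing_sum_exp_inner_le {v : ι → E} (hv : ∀ i, ‖v i‖ ≤ 1) (θ : J → E) :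
    ∃ y : ι → ℝ, (∀ i, |y i| = 1) ∧
      ∑ j, Real.exp (inner ℝ (∑ i, y i • v i) (θ j)) ≤ ∑ j, Real.exp (4 * ‖θ j‖ ^ 2) := by
  refine (RoundsWithPivot.hasSigning (A := Finset.univ) (fun _ ↦ roundsWithPivot hv θ _)
    (x := 0) (by simp) (by simp)).mono (Finset.sum_le_sum fun j _ ↦ ?_)
  simp only [Pi.zero_apply, zero_smul, Finset.sum_const_zero, inner_zero_left, Real.exp_zero,
    one_mul]
  gcongr
  exact Submodule.norm_starProjection_apply_le _ _

end Walk

/-- **Banaszczyk's bound towards the Komlós conjecture.** There is an absolute constant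
`C > 0` such that for every `n ≥ 2` and every `n × n` real matrix `A` whose columns all
have `ℓ₂`-norm at most `1`, there is a sign vector `x ∈ {-1,1}^n` with
`‖Ax‖_∞ ≤ C √(log n)`. -/
theorem banaszczyk_komlos :
    ∃ C : ℝ, 0 < C ∧
      ∀ n : ℕ, 2 ≤ n → ∀ A : Matrix (Fin n) (Fin n) ℝ,
        (∀ j, Real.sqrt (∑ i, A i j ^ 2) ≤ 1) →
        ∃ x : Fin n → ℝ, (∀ i, x i = 1 ∨ x i = -1) ∧
          ∀ i, |A.mulVec x i| ≤ C * Real.sqrt (Real.log n) := by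
  refine ⟨6, by norm_num, fun n hn A hA ↦ ?_⟩
  have hn' : (2 : ℝ) ≤ n := by exact_mod_cast hn
  have hlog : 0 < Real.log n := Real.log_pos (by linarith)
  set s := Real.sqrt (Real.log n) with hs
  have hs0 : 0 < s := Real.sqrt_pos.mpr hlog
  have hs2 : s ^ 2 = Real.log n := Real.sq_sqrt hlog.le
  let v : Fin n → EuclideanSpace ℝ (Fin n) := fun j ↦ WithLp.toLp 2 fun i ↦ A i j
  have hv : ∀ j, ‖v j‖ ≤ 1 := fun j ↦ by
    simpa [EuclideanSpace.norm_eq, v] using hA j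
  let σ : Bool → ℝ := fun b ↦ if b then s else -s
  have hσ : ∀ b, σ b ^ 2 = s ^ 2 := by simp [σ]
  let θ : Fin n × Bool → EuclideanSpace ℝ (Fin n) := fun j ↦ EuclideanSpace.single j.1 (σ j.2)
  obtain ⟨y, hy, hsum⟩ := exists_signing_sum_exp_inner_le hv θ
  have hθ : ∀ j, ‖θ j‖ ^ 2 = Real.log n := fun j ↦ by
    simp only [θ, PiLp.norm_single, Real.norm_eq_abs, sq_abs, hσ, hs2]
  have hinner : ∀ j, inner ℝ (∑ i, y i • v i) (θ j) = σ j.2 * A.mulVec y j.1 := fun j ↦ by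
    simp [θ, v, EuclideanSpace.inner_single_right, Matrix.mulVec, dotProduct, mul_comm]
  have hbound : ∀ i b, σ b * A.mulVec y i ≤ 6 * s ^ 2 := by
    intro i b
    have h1 := (Finset.single_le_sum (f := fun j ↦ Real.exp (inner ℝ (∑ i, y i • v i) (θ j)))
      (fun j _ ↦ (Real.exp_pos _).le) (Finset.mem_univ (i, b))).trans hsum
    simp only [hθ, hinner, Finset.sum_const, Finset.card_univ, Fintype.card_prod,
      Fintype.card_fin, Fintype.card_bool, nsmul_eq_mul] at h1
    have h2 : ((n * 2 : ℕ) : ℝ) ≤ Real.exp (2 * Real.log n) := by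
      rw [two_mul, Real.exp_add, Real.exp_log (by linarith)]
      push_cast
      gcongr
    have h3 := h1.trans (mul_le_mul_of_nonneg_right h2 (Real.exp_pos _).le)
    rw [← Real.exp_add, Real.exp_le_exp] at h3
    linarith
  refine ⟨y, fun i ↦ eq_or_eq_neg_of_abs_eq (hy i), fun i ↦ abs_le.mpr ⟨?_, ?_⟩⟩
  · have := hbound i false
    simp only [σ, Bool.false_eq_true, if_false] at this
    refine le_of_mul_le_mul_left ?_ hs0
    linarith
  · have := hbound i true
    simp only [σ, if_true] at this
    refine le_of_mul_le_mul_left ?_ hs0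
    linarith
end
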